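/- Harish-Chandra/Itzykson–Zuber consequence: if A is a fixed n×n Hermitian matrix with distinct eigenvalues a_1,…,a_n and Y is drawn from the n×n GUE, then for t > 0 the eigenvalue density of A + √t Y is (1/(n! (2πt)^{n/2})) · det[e^{-(x_i - a_j)²/(2t)}]_{i,j=1,…,n} · det[x_i^{j-1}] / det[a_i^{j-1}]. -/

import Mathlib

open MeasureTheory Matrix

open scoped ENNReal

noncomputable section

/-- Parameter space for an `n×n` Hermitian matrix: the diagonal entries, and the
real and imaginary parts of the above-diagonal entries. -/
abbrev HermParam (n : ℕ) :=
  (Fin n → ℝ) × ({ p : Fin n × Fin n // p.1 < p.2 } → ℝ × ℝ)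

/-- The Hermitian matrix built from the parameters. -/
def paramMatrix {n : ℕ} (e : HermParam n) : Matrix (Fin n) (Fin n) ℂ :=
  Matrix.of fun i j =>
    if h : i < j then ⟨(e.2 ⟨(i, j), h⟩).1, (e.2 ⟨(i, j), h⟩).2⟩
    else if h' : j < i then ⟨(e.2 ⟨(j, i), h'⟩).1, -(e.2 ⟨(j, i), h'⟩).2⟩
    else ((e.1 i : ℝ) : ℂ)

lemma paramMatrix_isHermitian {n : ℕ} (e : HermParam n) :
    (paramMatrix e).IsHermitian := by
  ext i j
  simp only [paramMatrix, conjTranspose_apply, Matrix.of_apply]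
  rcases lt_trichotomy i j with h | h | h
  · rw [dif_neg (lt_asymm h), dif_pos h, dif_pos h]
    simp [Complex.ext_iff]
  · subst h
    rw [dif_neg (lt_irrefl i), dif_neg (lt_irrefl i)]
    exact Complex.conj_ofReal _
  · rw [dif_pos h, dif_neg (lt_asymm h), dif_pos h]
    simp [Complex.ext_iff]

/-- The GUE measure on the parameter space: diagonal entries standard real
Gaussians, real and imaginary parts of the off-diagonal entries independent
centered Gaussians of variance `1/2`. -/
def gueParamMeasure (n : ℕ) : Measure (HermParam n) :=
  (Measure.pi fun _ : Fin n => ProbabilityTheory.gaussianReal 0 1).prod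
    (Measure.pi fun _ : { p : Fin n × Fin n // p.1 < p.2 } =>
      (ProbabilityTheory.gaussianReal 0 (1 / 2)).prod
        (ProbabilityTheory.gaussianReal 0 (1 / 2)))

lemma shift_isHermitian {n : ℕ} {A : Matrix (Fin n) (Fin n) ℂ}
    (hA : A.IsHermitian) (t : ℝ) (e : HermParam n) :
    (A + ((Real.sqrt t : ℝ) : ℂ) • paramMatrix e).IsHermitian := by
  have h1 := paramMatrix_isHermitian e
  unfold Matrix.IsHermitian at *
  rw [conjTranspose_add, conjTranspose_smul, h1, hA, Complex.star_def,
    Complex.conj_ofReal]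

namespace HCIZ

/-- Heat polynomials in one variable, as polynomials in the time. -/
def hq (v x : ℂ) : ℕ → Polynomial ℂ
  | 0 => 1
  | 1 => Polynomial.C x
  | m + 2 => Polynomial.C x * hq v x (m + 1) +
      Polynomial.C (v * (m + 1)) * Polynomial.X * hq v x m

lemma hq_deriv_add (v x : ℂ) (m : ℕ) :
    Polynomial.derivative (hq v x (m + 2)) =
      Polynomial.C (v / 2 * (m + 2) * (m + 1)) * hq v x m := by
  have key : ∀ m, Polynomial.derivative (hq v x (m + 2)) =
      Polynomial.C (v / 2 * (m + 2) * (m + 1)) * hq v x m ∧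
      Polynomial.derivative (hq v x (m + 3)) =
      Polynomial.C (v / 2 * (m + 3) * (m + 2)) * hq v x (m + 1) := by
    intro m
    have h2 : (Polynomial.C (v / 2) : Polynomial ℂ) * 2 = Polynomial.C v := by
      rw [show (2 : Polynomial ℂ) = Polynomial.C 2 by rw [map_ofNat], ← Polynomial.C_mul]; congr 1; ring
    induction m with
    | zero =>
      constructor
      · simp only [hq]
        simp
      · simp only [hq]
        simp
        simp only [map_ofNat]
        linear_combination - 3 * Polynomial.C x * h2
    | succ m ih =>
      refine ⟨?_, ?_⟩
      · have := ih.2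
        push_cast
        rw [show m + 1 + 2 = m + 3 by ring, this]
        congr 2; ring
      · rw [show m + 1 + 3 = (m + 2) + 2 by ring]
        rw [hq]
        rw [show m + 2 + 1 = m + 3 by ring]
        simp only [Polynomial.derivative_add, Polynomial.derivative_mul, Polynomial.derivative_C,
          Polynomial.derivative_X, ih.1, ih.2]
        have e : hq v x (m + 2) = Polynomial.C x * hq v x (m + 1) +
          Polynomial.C (v * (m + 1)) * Polynomial.X * hq v x m := by rw [hq]
        rw [show m + 1 + 1 = m + 2 by ring]
        push_cast
        simp only [Polynomial.C_mul, Polynomial.C_add, map_natCast, map_ofNat,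
          Polynomial.C_1] at e ⊢
        rw [← h2] at e ⊢
        linear_combination - (Polynomial.C (v / 2) * (m + 3) * (m + 2)) * e
  exact (key m).1

lemma hq_deriv (v x : ℂ) (m : ℕ) :
    Polynomial.derivative (hq v x m) =
      Polynomial.C (v / 2 * (m * (m - 1 : ℕ))) * hq v x (m - 2) := by
  match m with
  | 0 => simp [hq]
  | 1 => simp [hq]
  | m + 2 =>
    rw [hq_deriv_add]
    simp only [Nat.add_sub_cancel, show m + 2 - 1 = m + 1 by omega]
    push_cast
    congr 2; ring

lemma hq_eval_zero (v x : ℂ) (m : ℕ) : (hq v x m).eval 0 = x ^ m := by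
  have : (hq v x m).eval 0 = x ^ m ∧ (hq v x (m + 1)).eval 0 = x ^ (m + 1) := by
    induction m with
    | zero => simp [hq]
    | succ m ih =>
      refine ⟨ih.2, ?_⟩
      rw [hq]; simp [ih.2]; ring
  exact this.1

variable {I J : Type*} [Fintype I] [Fintype J]

/-- Heat flow of a polynomial evaluated at a point, as a polynomial in time. -/
def H (v a : I → ℂ) : MvPolynomial I ℂ →ₗ[ℂ] Polynomial ℂ :=
  (MvPolynomial.basisMonomials I ℂ).constr ℂ (fun m => ∏ i, hq (v i) (a i) (m i))

lemma H_monomial (v a : I → ℂ) (m : I →₀ ℕ) (c : ℂ) :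
    H v a (MvPolynomial.monomial m c) = Polynomial.C c * ∏ i, hq (v i) (a i) (m i) := by
  have : MvPolynomial.monomial m c = c • MvPolynomial.basisMonomials I ℂ m := by
    simp [MvPolynomial.smul_monomial]
  rw [this, map_smul, H, Module.Basis.constr_basis, Polynomial.smul_eq_C_mul]

/-- Weighted Laplacian on polynomials. -/
def Lap (v : I → ℂ) : MvPolynomial I ℂ →ₗ[ℂ] MvPolynomial I ℂ :=
  ∑ i, v i • ((MvPolynomial.pderiv i).toLinearMap ∘ₗ (MvPolynomial.pderiv i).toLinearMap)

lemma Lap_apply (v : I → ℂ) (F : MvPolynomial I ℂ) :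
    Lap v F = ∑ i, v i • MvPolynomial.pderiv i (MvPolynomial.pderiv i F) := by
  simp [Lap, LinearMap.sum_apply]

lemma H_deriv (v a : I → ℂ) (F : MvPolynomial I ℂ) :
    Polynomial.derivative (H v a F) = Polynomial.C (1 / 2) * H v a (Lap v F) := by
  classical
  induction F using MvPolynomial.induction_on' with
  | add p q hp hq =>
    rw [map_add, map_add, map_add, map_add, mul_add, hp, hq]
  | monomial m c =>
    rw [H_monomial, Lap_apply, map_sum, Polynomial.derivative_mul, Polynomial.derivative_C,
      zero_mul, zero_add, Polynomial.derivative_prod_finset, Finset.mul_sum, Finset.mul_sum]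
    refine Finset.sum_congr rfl fun i _ => ?_
    rw [map_smul, MvPolynomial.pderiv_monomial, MvPolynomial.pderiv_monomial, H_monomial,
      hq_deriv, ← Finset.mul_prod_erase Finset.univ _ (Finset.mem_univ i)]
    have h1 : ∏ j ∈ Finset.univ.erase i, hq (v j) (a j)
        ((m - Finsupp.single i 1 - Finsupp.single i 1 : I →₀ ℕ) j) =
        ∏ j ∈ Finset.univ.erase i, hq (v j) (a j) (m j) := by
      refine Finset.prod_congr rfl fun j hj => ?_
      have : i ≠ j := fun h => (Finset.ne_of_mem_erase hj) h.symm
      simp [this]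
    rw [h1, Polynomial.smul_eq_C_mul]
    have h2 : (m - Finsupp.single i 1 - Finsupp.single i 1 : I →₀ ℕ) i = m i - 2 := by
      simp; omega
    rw [h2]
    simp only [Finsupp.tsub_apply, Finsupp.single_eq_same, div_eq_mul_inv, Polynomial.C_mul, Polynomial.C_1]
    ring

lemma H_eval_zero (v a : I → ℂ) (F : MvPolynomial I ℂ) :
    (H v a F).eval 0 = MvPolynomial.eval a F := by
  induction F using MvPolynomial.induction_on' with
  | monomial m c =>
    rw [H_monomial, MvPolynomial.eval_monomial, Polynomial.eval_mul, Polynomial.eval_C,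
      Polynomial.eval_prod]
    simp [hq_eval_zero, Finsupp.prod_fintype]
  | add p q hp hq => simp [hp, hq]

lemma H_iter (v a : I → ℂ) (F : MvPolynomial I ℂ) (k : ℕ) :
    Polynomial.derivative^[k] (H v a F) = Polynomial.C ((1 / 2) ^ k) * H v a ((Lap v)^[k] F) := by
  induction k with
  | zero => simp
  | succ k ih =>
    rw [Function.iterate_succ_apply', ih, Function.iterate_succ_apply', Polynomial.derivative_C_mul,
      H_deriv, pow_succ, Polynomial.C_mul, mul_assoc]

lemma poly_ext {p q : Polynomial ℂ}
    (h : ∀ k, (Polynomial.derivative^[k] p).eval 0 = (Polynomial.derivative^[k] q).eval 0) :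
    p = q := by
  ext k
  have := h k
  rw [← Polynomial.coeff_zero_eq_eval_zero, ← Polynomial.coeff_zero_eq_eval_zero,
    Polynomial.coeff_iterate_derivative, Polynomial.coeff_iterate_derivative] at this
  simp only [zero_add, Nat.descFactorial_self, nsmul_eq_mul] at this
  exact mul_left_cancel₀ (by exact_mod_cast Nat.factorial_ne_zero k) this

lemma H_eq (v a : I → ℂ) (w b : J → ℂ) (F : MvPolynomial I ℂ) (G : MvPolynomial J ℂ) (κ : ℂ)
    (h : ∀ k, κ * MvPolynomial.eval a ((Lap v)^[k] F) = MvPolynomial.eval b ((Lap w)^[k] G)) :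
    Polynomial.C κ * H v a F = H w b G := by
  apply poly_ext
  intro k
  rw [Polynomial.iterate_derivative_C_mul, H_iter, H_iter]
  simp only [Polynomial.eval_mul, Polynomial.eval_C, H_eval_zero, ← h k]
  ring

end HCIZ
namespace HCIZ

section Abstract
variable {n : ℕ} {R : Type*} [CommRing R] [Algebra ℂ R] (M : Matrix (Fin n) (Fin n) R)
  (d : Fin n → Fin n → Derivation ℂ R R)

lemma d_pow (hd : ∀ i j k l, d i j (M k l) = if i = k ∧ j = l then 1 else 0)
    (i j : Fin n) (k : ℕ) (a b : Fin n) :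
    d i j ((M ^ k) a b) = ∑ c ∈ Finset.range k, (M ^ c) a i * (M ^ (k - 1 - c)) j b := by
  induction k generalizing a b with
  | zero =>
    simp only [pow_zero, Matrix.one_apply, Finset.range_zero, Finset.sum_empty]
    split_ifs <;> simp
  | succ k ih =>
    rw [pow_succ', Matrix.mul_apply, map_sum]
    simp only [Derivation.leibniz, smul_eq_mul, ih, hd]
    rw [Finset.sum_range_succ', Finset.sum_add_distrib, add_comm]
    rw [add_comm]
    congr 1
    · simp only [Finset.mul_sum]
      rw [Finset.sum_comm]
      refine Finset.sum_congr rfl fun c hc => ?_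
      rw [pow_succ', Matrix.mul_apply, Finset.sum_mul]
      refine Finset.sum_congr rfl fun l _ => ?_
      rw [show k + 1 - 1 - (c + 1) = k - 1 - c by omega]
      ring
    · simp only [pow_zero, Matrix.one_apply]
      by_cases h : i = a
      · subst h; simp
      · have h' : ¬ a = i := fun h' => h h'.symm
        simp [h, h']

lemma d_trace (hd : ∀ i j k l, d i j (M k l) = if i = k ∧ j = l then 1 else 0)
    (i j : Fin n) (k : ℕ) :
    d i j ((M ^ (k + 1)).trace) = (k + 1 : ℕ) * (M ^ k) j i := by
  rw [Matrix.trace, map_sum]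
  simp only [Matrix.diag_apply, d_pow M d hd]
  rw [Finset.sum_comm]
  rw [Finset.sum_congr rfl (g := fun _ => (M ^ k) j i)]
  · simp
  · intro c hc
    rw [Finset.mem_range] at hc
    rw [show k = (k + 1 - 1 - c) + c by omega, pow_add, Matrix.mul_apply,
      show (k + 1 - 1 - c + c + 1 - 1 - c) = k + 1 - 1 - c by omega]
    exact Finset.sum_congr rfl fun l _ => mul_comm _ _

/-- The Laplacian associated with the derivations. -/
def DD (F : R) : R := ∑ i, ∑ j, d i j (d j i F)

/-- The associated bilinear form. -/
def GG (F G : R) : R := ∑ i, ∑ j, d i j F * d j i G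

lemma DD_mul (F G : R) : DD d (F * G) = F * DD d G + G * DD d F + 2 * GG d F G := by
  have hs : GG d F G = ∑ i, ∑ j, d j i F * d i j G := by
    rw [GG, Finset.sum_comm]
  rw [two_mul]
  nth_rewrite 2 [hs]
  simp only [DD, GG, Finset.mul_sum, ← Finset.sum_add_distrib]
  refine Finset.sum_congr rfl fun i _ => Finset.sum_congr rfl fun j _ => ?_
  simp only [Derivation.leibniz, smul_eq_mul, map_add]
  ring

lemma DD_add (F G : R) : DD d (F + G) = DD d F + DD d G := by
  simp [DD, Finset.sum_add_distrib]

lemma DD_algebraMap (c : ℂ) : DD d (algebraMap ℂ R c) = 0 := by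
  simp [DD]

lemma GG_add (F G G' : R) : GG d F (G + G') = GG d F G + GG d F G' := by
  simp [GG, mul_add, Finset.sum_add_distrib]

lemma GG_mul (F G G' : R) : GG d F (G * G') = G * GG d F G' + G' * GG d F G := by
  simp only [GG, Derivation.leibniz, smul_eq_mul, Finset.mul_sum, ← Finset.sum_add_distrib]
  refine Finset.sum_congr rfl fun i _ => Finset.sum_congr rfl fun j _ => ?_
  ring

lemma GG_comm (F G : R) : GG d F G = GG d G F := by
  rw [GG, GG, Finset.sum_comm]
  exact Finset.sum_congr rfl fun i _ => Finset.sum_congr rfl fun j _ => mul_comm _ _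

lemma GG_algebraMap (F : R) (c : ℂ) : GG d F (algebraMap ℂ R c) = 0 := by
  simp [GG]

lemma GG_trace (hd : ∀ i j k l, d i j (M k l) = if i = k ∧ j = l then 1 else 0) (k l : ℕ) :
    GG d ((M ^ (k + 1)).trace) ((M ^ (l + 1)).trace) =
      ((k + 1 : ℕ) * (l + 1 : ℕ) : R) * (M ^ (k + l)).trace := by
  simp only [GG, d_trace M d hd]
  rw [pow_add, Matrix.trace, Finset.mul_sum, Finset.sum_comm]
  refine Finset.sum_congr rfl fun i _ => ?_
  rw [Matrix.diag_apply, Matrix.mul_apply, Finset.mul_sum]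
  exact Finset.sum_congr rfl fun j _ => by ring

lemma DD_trace (hd : ∀ i j k l, d i j (M k l) = if i = k ∧ j = l then 1 else 0) (k : ℕ) :
    DD d ((M ^ (k + 1)).trace) =
      (k + 1 : ℕ) * ∑ c ∈ Finset.range k, (M ^ c).trace * (M ^ (k - 1 - c)).trace := by
  simp only [DD, d_trace M d hd, Derivation.leibniz, smul_eq_mul, Derivation.map_natCast, mul_zero,
    add_zero, d_pow M d hd]
  simp only [← Finset.mul_sum]
  congr 1
  simp only [Matrix.trace, Matrix.diag_apply, Finset.sum_mul_sum]
  rw [Finset.sum_congr rfl (fun i _ => Finset.sum_comm), Finset.sum_comm]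

end Abstract

section Sside
variable (n : ℕ)
open MvPolynomial

/-- The Vandermonde polynomial. -/
def VV : MvPolynomial (Fin n) ℂ := (Matrix.vandermonde (X : Fin n → MvPolynomial (Fin n) ℂ)).det

/-- power sums -/
def pp (k : ℕ) : MvPolynomial (Fin n) ℂ := ∑ i, X i ^ k

/-- Euclidean Laplacian -/
def D0 (f : MvPolynomial (Fin n) ℂ) : MvPolynomial (Fin n) ℂ := ∑ i, pderiv i (pderiv i f)

/-- Euclidean bilinear form -/
def G0 (f g : MvPolynomial (Fin n) ℂ) : MvPolynomial (Fin n) ℂ := ∑ i, pderiv i f * pderiv i g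

variable {n}
lemma D0_mul (f g : MvPolynomial (Fin n) ℂ) :
    D0 n (f * g) = f * D0 n g + g * D0 n f + 2 * G0 n f g := by
  simp only [D0, G0, Finset.mul_sum, ← Finset.sum_add_distrib]
  refine Finset.sum_congr rfl fun i _ => ?_
  simp only [Derivation.leibniz, smul_eq_mul, map_add]
  ring

lemma D0_add (f g : MvPolynomial (Fin n) ℂ) : D0 n (f + g) = D0 n f + D0 n g := by
  simp [D0, Finset.sum_add_distrib]

lemma G0_add (f g g' : MvPolynomial (Fin n) ℂ) : G0 n f (g + g') = G0 n f g + G0 n f g' := by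
  simp [G0, mul_add, Finset.sum_add_distrib]

lemma G0_mul (f g g' : MvPolynomial (Fin n) ℂ) :
    G0 n f (g * g') = g * G0 n f g' + g' * G0 n f g := by
  simp only [G0, Derivation.leibniz, smul_eq_mul, Finset.mul_sum, ← Finset.sum_add_distrib]
  refine Finset.sum_congr rfl fun i _ => ?_
  ring

lemma G0_comm (f g : MvPolynomial (Fin n) ℂ) : G0 n f g = G0 n g f :=
  Finset.sum_congr rfl fun i _ => mul_comm _ _

lemma pderiv_pp (i : Fin n) (k : ℕ) : pderiv i (pp n (k + 1)) =
    ((k + 1 : ℕ) : MvPolynomial (Fin n) ℂ) * X i ^ k := by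
  classical
  rw [pp, map_sum, Finset.sum_eq_single i]
  · rw [pderiv_pow]; simp
  · intro j _ hj
    rw [pderiv_pow, pderiv_X_of_ne hj]; simp
  · simp

lemma G0_pp (k l : ℕ) : G0 n (pp n (k + 1)) (pp n (l + 1)) =
    ((k + 1 : ℕ) * (l + 1 : ℕ)) * pp n (k + l) := by
  simp only [G0, pderiv_pp]
  rw [pp, Finset.mul_sum]
  exact Finset.sum_congr rfl fun i _ => by ring

lemma D0_pp (k : ℕ) : D0 n (pp n (k + 1)) = ((k + 1 : ℕ) * k) * pp n (k - 1) := by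
  simp only [D0, pderiv_pp]
  rw [pp, Finset.mul_sum]
  refine Finset.sum_congr rfl fun i _ => ?_
  rw [Derivation.leibniz, Derivation.map_natCast, pderiv_pow]
  simp only [smul_eq_mul, pderiv_X_self]
  ring

/-- Euler type vector field. -/
def EE (n k : ℕ) : Derivation ℂ (MvPolynomial (Fin n) ℂ) (MvPolynomial (Fin n) ℂ) :=
  MvPolynomial.mkDerivation ℂ (fun i => X i ^ k)

lemma EE_apply (k : ℕ) (f : MvPolynomial (Fin n) ℂ) :
    EE n k f = ∑ i, pderiv i f * X i ^ k := by
  classical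
  induction f using MvPolynomial.induction_on with
  | C a => simp [EE]
  | add p q hp hq => simp [hp, hq, add_mul, Finset.sum_add_distrib]
  | mul_X p i hp =>
    simp only [Derivation.leibniz, smul_eq_mul, hp, add_mul, Finset.sum_add_distrib, Finset.mul_sum]
    congr 1
    · rw [Finset.sum_eq_single i]
      · simp [EE]
      · intro j _ hj
        simp [pderiv_X_of_ne hj.symm]
      · simp
    · exact Finset.sum_congr rfl fun j _ => by ring

lemma deriv_prod {R ι : Type*} [CommRing R] [Algebra ℂ R] (E : Derivation ℂ R R) (s : Finset ι)
    (u h : ι → R) (hu : ∀ i ∈ s, E (u i) = h i * u i) :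
    E (∏ i ∈ s, u i) = (∑ i ∈ s, h i) * ∏ i ∈ s, u i := by
  classical
  induction s using Finset.induction_on with
  | empty => simp
  | insert a s ha ih =>
    rw [Finset.prod_insert ha, Finset.sum_insert ha, Derivation.leibniz, hu _ (by simp),
      ih (fun i hi => hu i (by simp [hi]))]
    simp only [smul_eq_mul]; ring

lemma EE_VV (k : ℕ) : EE n k (VV n) =
    (∑ i : Fin n, ∑ j ∈ Finset.Ioi i, ∑ c ∈ Finset.range k,
      (X j : MvPolynomial (Fin n) ℂ) ^ c * X i ^ (k - 1 - c)) * VV n := by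
  rw [VV, Matrix.det_vandermonde]
  apply deriv_prod
  intro i _
  apply deriv_prod
  intro j _
  rw [(Commute.all _ _).geom_sum₂_mul, map_sub, EE, mkDerivation_X, mkDerivation_X]

lemma sum_sym {R : Type*} [CommRing R] (h : Fin n → Fin n → R) (hs : ∀ i j, h i j = h j i) :
    2 * (∑ i : Fin n, ∑ j ∈ Finset.Ioi i, h i j) + ∑ i, h i i = ∑ i, ∑ j, h i j := by
  have h1 : ∑ i : Fin n, ∑ j ∈ Finset.Ioi i, h i j = ∑ i : Fin n, ∑ j ∈ Finset.Iio i, h i j := by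
    rw [Finset.sum_comm' (t' := Finset.univ) (s' := fun j => Finset.Iio j) (by simp)]
    exact Finset.sum_congr rfl fun i _ => Finset.sum_congr rfl fun j _ => hs _ _
  rw [two_mul]
  nth_rewrite 2 [h1]
  rw [← Finset.sum_add_distrib, ← Finset.sum_add_distrib]
  refine Finset.sum_congr rfl fun i _ => ?_
  have : (Finset.univ : Finset (Fin n)) = (Finset.Ioi i ∪ Finset.Iio i) ∪ {i} := by
    ext j
    simp only [Finset.mem_univ, Finset.mem_union, Finset.mem_Ioi, Finset.mem_Iio,
      Finset.mem_singleton, true_iff]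
    rcases lt_trichotomy i j with h | h | h
    · exact Or.inl (Or.inl h)
    · exact Or.inr h.symm
    · exact Or.inl (Or.inr h)
  rw [this, Finset.sum_union, Finset.sum_union, Finset.sum_singleton]
  · rw [Finset.disjoint_left]; intro a ha hb
    rw [Finset.mem_Ioi] at ha; rw [Finset.mem_Iio] at hb; exact lt_asymm ha hb
  · rw [Finset.disjoint_left]; intro a ha hb
    rw [Finset.mem_singleton] at hb
    simp [hb] at ha

lemma VV_pp (k : ℕ) : VV n * D0 n (pp n (k + 1)) + 2 * G0 n (VV n) (pp n (k + 1)) =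
    VV n * ((k + 1 : ℕ) * ∑ c ∈ Finset.range k, pp n c * pp n (k - 1 - c)) := by
  have h1 : G0 n (VV n) (pp n (k + 1)) = (k + 1 : ℕ) * EE n k (VV n) := by
    rw [EE_apply, G0, Finset.mul_sum]
    refine Finset.sum_congr rfl fun i _ => ?_
    rw [pderiv_pp]; ring
  rw [h1, EE_VV, D0_pp]
  have h2 := sum_sym (n := n) (fun i j => ∑ c ∈ Finset.range k,
      (X j : MvPolynomial (Fin n) ℂ) ^ c * X i ^ (k - 1 - c)) (by
    intro i j
    rw [← Finset.sum_range_reflect]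
    refine Finset.sum_congr rfl fun c hc => ?_
    rw [Finset.mem_range] at hc
    rw [show k - 1 - (k - 1 - c) = c by omega, mul_comm])
  have h3 : ∑ i : Fin n, ∑ j : Fin n, ∑ c ∈ Finset.range k,
      (X j : MvPolynomial (Fin n) ℂ) ^ c * X i ^ (k - 1 - c) =
      ∑ c ∈ Finset.range k, pp n c * pp n (k - 1 - c) := by
    rw [Finset.sum_congr rfl (fun i _ => Finset.sum_comm), Finset.sum_comm]
    refine Finset.sum_congr rfl fun c _ => ?_
    rw [pp, pp, Finset.sum_mul_sum, Finset.sum_comm]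
  have h4 : ∑ i : Fin n, ∑ c ∈ Finset.range k,
      (X i : MvPolynomial (Fin n) ℂ) ^ c * X i ^ (k - 1 - c) = k * pp n (k - 1) := by
    rw [pp, Finset.mul_sum]
    refine Finset.sum_congr rfl fun i _ => ?_
    rw [Finset.sum_congr rfl (g := fun _ => (X i : MvPolynomial (Fin n) ℂ) ^ (k - 1))]
    · simp
    · intro c hc
      rw [Finset.mem_range] at hc
      rw [← pow_add]; congr 1; omega
  rw [← h3, ← h2, h4]
  ring

lemma D0_VV : D0 n (VV n) = 0 := by
  classical
  have h1 : ∀ σ : Equiv.Perm (Fin n), D0 n (∏ i, X (σ i) ^ (i : ℕ)) =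
      ∑ j : Fin n, ∏ i, (Matrix.updateCol (Matrix.vandermonde (X : Fin n → MvPolynomial (Fin n) ℂ)) j
        (fun i => (((j : ℕ) * (j - 1 : ℕ) : ℕ) : MvPolynomial (Fin n) ℂ) * X i ^ ((j : ℕ) - 2)))
          (σ i) i := by
    intro σ
    rw [D0, ← Equiv.sum_comp σ]
    refine Finset.sum_congr rfl fun j _ => ?_
    have key : ∀ a b : MvPolynomial (Fin n) ℂ, pderiv (σ j) b = 0 →
        pderiv (σ j) (a * b) = pderiv (σ j) a * b := by
      intro a b hb
      rw [Derivation.leibniz, hb]; simp [mul_comm]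
    have hb : pderiv (σ j) (∏ i ∈ Finset.univ.erase j, (X (σ i) : MvPolynomial (Fin n) ℂ) ^ (i : ℕ)) = 0 := by
      rw [deriv_prod _ _ _ (fun _ => 0)]
      · simp
      · intro i hi
        rw [pderiv_pow, pderiv_X_of_ne]
        · simp
        · exact fun h => (Finset.ne_of_mem_erase hi) (σ.injective h)
    rw [← Finset.mul_prod_erase Finset.univ _ (Finset.mem_univ j), key _ _ hb, key _ _ hb,
      ← Finset.mul_prod_erase Finset.univ (fun i => (Matrix.updateCol _ j _) (σ i) i)
        (Finset.mem_univ j)]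
    congr 1
    · rw [Matrix.updateCol_self, pderiv_pow, pderiv_X_self, mul_one, Derivation.leibniz,
        Derivation.map_natCast, pderiv_pow, pderiv_X_self, Nat.sub_sub]
      simp only [smul_eq_mul]
      push_cast
      ring
    · refine Finset.prod_congr rfl fun i hi => ?_
      rw [Matrix.updateCol_ne (Finset.ne_of_mem_erase hi), Matrix.vandermonde_apply]
  have h2 : D0 n (VV n) = ∑ j : Fin n,
      (Matrix.updateCol (Matrix.vandermonde (X : Fin n → MvPolynomial (Fin n) ℂ)) j
        (fun i => (((j : ℕ) * (j - 1 : ℕ) : ℕ) : MvPolynomial (Fin n) ℂ) * X i ^ ((j : ℕ) - 2))).det := by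
    simp only [Matrix.det_apply]
    rw [Finset.sum_comm]
    simp only [← Finset.smul_sum, ← h1]
    rw [VV, Matrix.det_apply]
    simp only [D0, map_sum, Units.smul_def, map_zsmul, Matrix.vandermonde_apply]
    rw [Finset.sum_comm]
    simp only [Finset.smul_sum]
  rw [h2]
  refine Finset.sum_eq_zero fun j _ => ?_
  by_cases hj : (j : ℕ) < 2
  · apply Matrix.det_eq_zero_of_column_eq_zero j
    intro i
    rw [Matrix.updateCol_self]
    have : (j : ℕ) * ((j : ℕ) - 1) = 0 := by
      rcases Nat.lt_succ_iff_lt_or_eq.1 hj with h | h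
      · simp [Nat.lt_one_iff.1 h]
      · simp [h]
    rw [this]; simp
  · have hj2 : (j : ℕ) - 2 < n := by omega
    have : (fun i => (((j : ℕ) * (j - 1 : ℕ) : ℕ) : MvPolynomial (Fin n) ℂ) * X i ^ ((j : ℕ) - 2)) =
      (((j : ℕ) * (j - 1 : ℕ) : ℕ) : MvPolynomial (Fin n) ℂ) •
        (fun i => Matrix.vandermonde (X : Fin n → MvPolynomial (Fin n) ℂ) i ⟨(j : ℕ) - 2, hj2⟩) := by
      ext i; simp [Matrix.vandermonde_apply]
    rw [this, Matrix.det_updateCol_smul, Matrix.det_updateCol_eq_zero, mul_zero]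
    intro h
    have := congrArg Fin.val h
    simp at this; omega

end Sside
end HCIZ
namespace HCIZ
open MvPolynomial

section Rel
variable {n : ℕ} {R : Type*} [CommRing R] [Algebra ℂ R] (M : Matrix (Fin n) (Fin n) R)
  (d : Fin n → Fin n → Derivation ℂ R R)

/-- Generators of the algebra of corresponding pairs of invariants. -/
def gens : Set (R × MvPolynomial (Fin n) ℂ) := Set.range fun k : ℕ => ((M ^ k).trace, pp n k)

/-- The algebra of corresponding pairs of invariants. -/
def KK : Subalgebra ℂ (R × MvPolynomial (Fin n) ℂ) := Algebra.adjoin ℂ (gens M)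

lemma gen_mem (k : ℕ) : ((M ^ k).trace, pp n k) ∈ KK M :=
  Algebra.subset_adjoin ⟨k, rfl⟩

lemma D0_C (c : ℂ) : D0 n (C c) = 0 := by simp [D0]

lemma G0_C (f : MvPolynomial (Fin n) ℂ) (c : ℂ) : G0 n f (C c) = 0 := by simp [G0]

lemma trace_zero' : (M ^ 0).trace = algebraMap ℂ R n := by simp

lemma pp_zero : pp n 0 = C (n : ℂ) := by simp [pp]

lemma KK_GG (hd : ∀ i j k l, d i j (M k l) = if i = k ∧ j = l then 1 else 0)
    {x y : R × MvPolynomial (Fin n) ℂ} (hx : x ∈ KK M) (hy : y ∈ KK M) :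
    (GG d x.1 y.1, G0 n x.2 y.2) ∈ KK M := by
  have aux : ∀ x : R × MvPolynomial (Fin n) ℂ,
      (∀ k : ℕ, (GG d x.1 (M ^ (k + 1)).trace, G0 n x.2 (pp n (k + 1))) ∈ KK M) →
      ∀ y ∈ KK M, (GG d x.1 y.1, G0 n x.2 y.2) ∈ KK M := by
    intro x hx y hy
    induction hy using Algebra.adjoin_induction with
    | mem y hy =>
      obtain ⟨k, rfl⟩ := hy
      cases k with
      | zero =>
        simp only
        rw [trace_zero', pp_zero, GG_algebraMap, G0_C]
        exact (KK M).zero_mem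
      | succ k => exact hx k
    | algebraMap c =>
      simp only [Prod.algebraMap_apply]
      rw [GG_algebraMap, MvPolynomial.algebraMap_eq, G0_C]
      exact (KK M).zero_mem
    | add y z _ _ hy hz =>
      simp only [Prod.fst_add, Prod.snd_add, GG_add, G0_add]
      exact (KK M).add_mem hy hz
    | mul y z hy' hz' hy hz =>
      simp only [Prod.fst_mul, Prod.snd_mul, GG_mul, G0_mul]
      exact (KK M).add_mem ((KK M).mul_mem hy' hz) ((KK M).mul_mem hz' hy)
  refine aux x (fun k => ?_) y hy
  rw [GG_comm, G0_comm]
  refine aux ((M ^ (k + 1)).trace, pp n (k + 1)) (fun l => ?_) x hx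
  simp only
  rw [GG_trace M d hd, G0_pp]
  have h1 : (((k + 1 : ℕ) * (l + 1 : ℕ) : R), (((k + 1 : ℕ) * (l + 1 : ℕ)) : MvPolynomial (Fin n) ℂ)) ∈ KK M := by
    have := (KK M).natCast_mem ((k + 1) * (l + 1))
    convert this using 1
    ext <;> simp
  exact (KK M).mul_mem h1 (gen_mem M (k + l))

lemma KK_DD (hd : ∀ i j k l, d i j (M k l) = if i = k ∧ j = l then 1 else 0)
    {x : R × MvPolynomial (Fin n) ℂ} (hx : x ∈ KK M) :
    ∃ f, (DD d x.1, f) ∈ KK M ∧ VV n * D0 n x.2 + 2 * G0 n (VV n) x.2 = VV n * f := by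
  induction hx using Algebra.adjoin_induction with
  | mem y hy =>
    obtain ⟨k, rfl⟩ := hy
    cases k with
    | zero =>
      refine ⟨0, ?_, ?_⟩
      · simp only
        rw [trace_zero', DD_algebraMap]
        exact (KK M).zero_mem
      · simp only
        rw [pp_zero, G0_C, D0_C]; simp
    | succ k =>
      refine ⟨_, ?_, VV_pp k⟩
      simp only
      rw [DD_trace M d hd]
      have h0 : ((∑ c ∈ Finset.range k, (M ^ c).trace * (M ^ (k - 1 - c)).trace),
          (∑ c ∈ Finset.range k, pp n c * pp n (k - 1 - c))) ∈ KK M := by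
        have := (KK M).sum_mem (t := Finset.range k) (f := fun c => ((M ^ c).trace, pp n c) *
          ((M ^ (k - 1 - c)).trace, pp n (k - 1 - c)))
          (fun c _ => (KK M).mul_mem (gen_mem M _) (gen_mem M _))
        convert this using 1
        ext1 <;> simp [Prod.fst_sum, Prod.snd_sum]
      exact (KK M).mul_mem ((KK M).natCast_mem (k + 1)) h0
  | algebraMap c =>
    refine ⟨0, ?_, ?_⟩
    · simp only [Prod.algebraMap_apply]
      rw [DD_algebraMap]; exact (KK M).zero_mem
    · simp only [Prod.algebraMap_apply]
      rw [MvPolynomial.algebraMap_eq, G0_C, D0_C]; simp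
  | add y z _ _ hy hz =>
    obtain ⟨f, hf, ef⟩ := hy
    obtain ⟨g, hg, eg⟩ := hz
    refine ⟨f + g, ?_, ?_⟩
    · rw [Prod.fst_add, DD_add]; exact (KK M).add_mem hf hg
    · rw [Prod.snd_add, D0_add, G0_add]; linear_combination ef + eg
  | mul y z hy' hz' hy hz =>
    obtain ⟨f, hf, ef⟩ := hy
    obtain ⟨g, hg, eg⟩ := hz
    refine ⟨y.2 * g + z.2 * f + (2 : ℕ) * G0 n y.2 z.2, ?_, ?_⟩
    · rw [Prod.fst_mul, DD_mul]
      have := (KK M).add_mem ((KK M).add_mem ((KK M).mul_mem hy' hg) ((KK M).mul_mem hz' hf))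
        ((KK M).mul_mem ((KK M).natCast_mem 2) (KK_GG M d hd hy' hz'))
      convert this using 1
      ext1 <;> simp
    · rw [Prod.snd_mul, D0_mul, G0_mul]; push_cast; linear_combination y.2 * eg + z.2 * ef

lemma KK_iter (hd : ∀ i j k l, d i j (M k l) = if i = k ∧ j = l then 1 else 0)
    {x : R × MvPolynomial (Fin n) ℂ} (hx : x ∈ KK M) (k : ℕ) :
    ∃ f, ((DD d)^[k] x.1, f) ∈ KK M ∧ (D0 n)^[k] (VV n * x.2) = VV n * f := by
  induction k with
  | zero => exact ⟨x.2, hx, rfl⟩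
  | succ k ih =>
    obtain ⟨f, hf, ef⟩ := ih
    obtain ⟨g, hg, eg⟩ := KK_DD M d hd hf
    refine ⟨g, ?_, ?_⟩
    · rw [Function.iterate_succ_apply']; exact hg
    · rw [Function.iterate_succ_apply', ef, D0_mul, D0_VV]
      linear_combination eg
end Rel

end HCIZ
namespace HCIZ
open MvPolynomial

section Conc

/-- index type of real coordinates -/
abbrev Idx (n : ℕ) := Fin n ⊕ ({ p : Fin n × Fin n // p.1 < p.2 } ⊕ { p : Fin n × Fin n // p.1 < p.2 })

/-- real coordinates -/
def coords {n : ℕ} (e : HermParam n) : Idx n → ℝ :=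
  Sum.elim e.1 (Sum.elim (fun p => (e.2 p).1) (fun p => (e.2 p).2))

/-- variances -/
def vr (n : ℕ) : Idx n → NNReal := Sum.elim (fun _ => 1) (fun _ => 1 / 2)

/-- complex variances -/
def vc (n : ℕ) : Idx n → ℂ := Sum.elim (fun _ => 1) (fun _ => 1 / 2)

/-- Generic hermitian matrix. -/
def GM (n : ℕ) : Matrix (Fin n) (Fin n) (MvPolynomial (Idx n) ℂ) :=
  Matrix.of fun i j =>
    if h : i < j then X (Sum.inr (Sum.inl ⟨(i, j), h⟩)) +
      C Complex.I * X (Sum.inr (Sum.inr ⟨(i, j), h⟩))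
    else if h' : j < i then X (Sum.inr (Sum.inl ⟨(j, i), h'⟩)) -
      C Complex.I * X (Sum.inr (Sum.inr ⟨(j, i), h'⟩))
    else X (Sum.inl i)

/-- Complex derivations. -/
def dd (n : ℕ) (i j : Fin n) : Derivation ℂ (MvPolynomial (Idx n) ℂ) (MvPolynomial (Idx n) ℂ) :=
    if h : i < j then (1 / 2 : ℂ) • (pderiv (Sum.inr (Sum.inl ⟨(i, j), h⟩)) -
      Complex.I • pderiv (Sum.inr (Sum.inr ⟨(i, j), h⟩)))
    else if h' : j < i then (1 / 2 : ℂ) • (pderiv (Sum.inr (Sum.inl ⟨(j, i), h'⟩)) +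
      Complex.I • pderiv (Sum.inr (Sum.inr ⟨(j, i), h'⟩)))
    else pderiv (Sum.inl i)

lemma dd_GM (n : ℕ) (i j k l : Fin n) :
    dd n i j (GM n k l) = if i = k ∧ j = l then 1 else 0 := by
  classical
  have hI : (C Complex.I : MvPolynomial (Idx n) ℂ) * C Complex.I = -1 := by
    rw [← C_mul, Complex.I_mul_I]; simp
  have h2 : (C (1 / 2 : ℂ) : MvPolynomial (Idx n) ℂ) * 2 = 1 := by
    rw [← C_1, ← map_ofNat C 2, ← C_mul]; norm_num
  have key : ∀ (p q : { p : Fin n × Fin n // p.1 < p.2 }),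
      pderiv (Sum.inr (Sum.inl p)) (X (Sum.inr (Sum.inl q)) : MvPolynomial (Idx n) ℂ) = (if p = q then 1 else 0) ∧
      pderiv (Sum.inr (Sum.inr p)) (X (Sum.inr (Sum.inr q)) : MvPolynomial (Idx n) ℂ) = (if p = q then 1 else 0) ∧
      pderiv (Sum.inr (Sum.inl p)) (X (Sum.inr (Sum.inr q)) : MvPolynomial (Idx n) ℂ) = 0 ∧
      pderiv (Sum.inr (Sum.inr p)) (X (Sum.inr (Sum.inl q)) : MvPolynomial (Idx n) ℂ) = 0 := by
    intro p q
    refine ⟨?_, ?_, ?_, ?_⟩ <;> rw [pderiv_X, Pi.single_apply] <;> simp [eq_comm]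
  have key2 : ∀ (p : { p : Fin n × Fin n // p.1 < p.2 }) (m : Fin n),
      pderiv (Sum.inr (Sum.inl p)) (X (Sum.inl m) : MvPolynomial (Idx n) ℂ) = 0 ∧
      pderiv (Sum.inr (Sum.inr p)) (X (Sum.inl m) : MvPolynomial (Idx n) ℂ) = 0 ∧
      pderiv (Sum.inl m) (X (Sum.inr (Sum.inl p)) : MvPolynomial (Idx n) ℂ) = 0 ∧
      pderiv (Sum.inl m) (X (Sum.inr (Sum.inr p)) : MvPolynomial (Idx n) ℂ) = 0 := by
    intro p m
    refine ⟨?_, ?_, ?_, ?_⟩ <;> rw [pderiv_X, Pi.single_apply] <;> simp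
  have key3 : ∀ (m k : Fin n),
      pderiv (Sum.inl m) (X (Sum.inl k) : MvPolynomial (Idx n) ℂ) = if m = k then 1 else 0 := by
    intro m k
    rw [pderiv_X, Pi.single_apply]; simp [eq_comm]
  have k11 := fun p q => (key p q).1
  have k12 := fun p q => (key p q).2.1
  have k13 := fun p q => (key p q).2.2.1
  have k14 := fun p q => (key p q).2.2.2
  have k21 := fun p q => (key2 p q).1
  have k22 := fun p q => (key2 p q).2.1
  have k23 := fun p q => (key2 p q).2.2.1
  have k24 := fun p q => (key2 p q).2.2.2
  have tri : ∀ i j : Fin n, (i < j ∧ ¬ j < i ∧ i ≠ j) ∨ (¬ i < j ∧ ¬ j < i ∧ i = j) ∨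
      (¬ i < j ∧ j < i ∧ i ≠ j) := by
    intro i j; omega
  rcases tri i j with ⟨h, g, f⟩ | ⟨h, g, f⟩ | ⟨h, g, f⟩ <;>
  rcases tri k l with ⟨h', g', f'⟩ | ⟨h', g', f'⟩ | ⟨h', g', f'⟩ <;>
    simp only [dd, GM, Matrix.of_apply, h, h', g, g', dite_true, dite_false,
      Derivation.smul_apply, Derivation.add_apply, Derivation.sub_apply, Derivation.leibniz, map_add, map_sub,
      derivation_C, smul_eq_C_mul, smul_zero, smul_eq_mul, k11, k12, k13, k14, k21, k22, k23, k24, key3,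
      Subtype.mk.injEq, Prod.mk.injEq] <;>
  by_cases e1 : i = k <;> by_cases e2 : j = l <;> by_cases e3 : i = l <;> by_cases e4 : j = k <;>
    simp only [e1, e2, e3, e4, and_self, and_true, true_and, and_false, false_and, if_true, if_false] <;>
    first
    | (exfalso; omega)
    | ring1
    | (rw [if_neg (by omega)]; ring1)
    | (rw [if_neg (by omega)]; linear_combination (C (1/2)) * hI)
    | linear_combination (-C (1/2)) * hI + h2
    | linear_combination (C (1/2)) * hI

lemma eval_GM (n : ℕ) (e : HermParam n) :
    (GM n).map (MvPolynomial.eval fun c => (coords e c : ℂ)) = paramMatrix e := by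
  ext i j
  simp only [GM, paramMatrix, Matrix.map_apply, Matrix.of_apply]
  split_ifs <;> simp [coords, Complex.ext_iff]

lemma sum_split {n : ℕ} {A : Type*} [AddCommMonoid A] (G : Fin n → Fin n → A) :
    ∑ i, ∑ j, G i j = ∑ i, G i i +
      ∑ p : { p : Fin n × Fin n // p.1 < p.2 }, (G p.1.1 p.1.2 + G p.1.2 p.1.1) := by
  classical
  rw [← Fintype.sum_prod_type' (f := G), Finset.sum_add_distrib]
  have e1 : ∑ i, G i i = ∑ x : Fin n × Fin n, if x.1 = x.2 then G x.1 x.2 else 0 := by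
    rw [Fintype.sum_prod_type]; simp
  have e2 : ∑ p : { p : Fin n × Fin n // p.1 < p.2 }, G p.1.1 p.1.2 =
      ∑ x : Fin n × Fin n, if x.1 < x.2 then G x.1 x.2 else 0 := by
    rw [← Finset.sum_filter]
    exact (Finset.sum_subtype _ (fun x => by simp) (fun x : Fin n × Fin n => G x.1 x.2)).symm
  have e3 : ∑ p : { p : Fin n × Fin n // p.1 < p.2 }, G p.1.2 p.1.1 =
      ∑ x : Fin n × Fin n, if x.2 < x.1 then G x.1 x.2 else 0 := by
    rw [← Equiv.sum_comp (Equiv.prodComm (Fin n) (Fin n)), ← Finset.sum_filter]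
    exact (Finset.sum_subtype _ (fun x => by rw [Finset.mem_filter]; simp) (fun x : Fin n × Fin n => G x.2 x.1)).symm
  rw [e1, e2, e3, ← Finset.sum_add_distrib, ← Finset.sum_add_distrib]
  refine Finset.sum_congr rfl fun x _ => ?_
  rcases lt_trichotomy x.1 x.2 with h | h | h
  · simp [h, h.ne, lt_asymm h]
  · simp [h]
  · simp [h, h.ne', lt_asymm h]

lemma pderiv_comm' {I : Type*} (i j : I) (F : MvPolynomial I ℂ) :
    pderiv i (pderiv j F) = pderiv j (pderiv i F) := by
  classical
  have : ⁅(pderiv i : Derivation ℂ (MvPolynomial I ℂ) (MvPolynomial I ℂ)),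
      (pderiv j : Derivation ℂ (MvPolynomial I ℂ) (MvPolynomial I ℂ))⁆ = 0 := by
    apply MvPolynomial.derivation_ext
    intro k
    rw [Derivation.commutator_apply, pderiv_X, pderiv_X]
    simp only [Pi.single_apply]
    split_ifs <;> simp
  have h := congrArg (fun D => D F) this
  simp only [Derivation.commutator_apply] at h
  exact sub_eq_zero.1 h

lemma Lap_eq_DD (n : ℕ) (F : MvPolynomial (Idx n) ℂ) : Lap (vc n) F = DD (dd n) F := by
  rw [Lap_apply, DD, sum_split, Fintype.sum_sum_type, Fintype.sum_sum_type, ← Finset.sum_add_distrib]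
  congr 1
  · simp [vc, dd]
  · refine Finset.sum_congr rfl fun p _ => ?_
    obtain ⟨⟨i, j⟩, h⟩ := p
    simp only at h
    simp only [dd, dif_pos h, dif_neg (lt_asymm h)]
    simp only [vc, Sum.elim_inr, Derivation.smul_apply, Derivation.add_apply, Derivation.sub_apply,
      Derivation.map_smul, Derivation.map_add, Derivation.map_sub]
    generalize (⟨(i, j), h⟩ : { p : Fin n × Fin n // p.1 < p.2 }) = p
    rw [pderiv_comm' (Sum.inr (Sum.inr p)) (Sum.inr (Sum.inl p))]
    have hI : (C Complex.I : MvPolynomial (Idx n) ℂ) * C Complex.I = -1 := by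
      rw [← C_mul, Complex.I_mul_I]; simp
    have h2 : (C (1 / 2 : ℂ) : MvPolynomial (Idx n) ℂ) * 2 = 1 := by
      rw [← C_1, ← map_ofNat C 2, ← C_mul]; norm_num
    simp only [smul_eq_C_mul]
    generalize pderiv (Sum.inr (Sum.inl p)) (pderiv (Sum.inr (Sum.inl p)) F) = x
    generalize pderiv (Sum.inr (Sum.inr p)) (pderiv (Sum.inr (Sum.inr p)) F) = y
    generalize pderiv (Sum.inr (Sum.inl p)) (pderiv (Sum.inr (Sum.inr p)) F) = z
    linear_combination (-C (1/2) * (x + y)) * h2 + 2 * C (1 / 2)^2 * y * hI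

lemma Lap_eq_D0 (n : ℕ) (F : MvPolynomial (Fin n) ℂ) : Lap (fun _ => 1) F = D0 n F := by
  rw [Lap_apply, D0]; simp

end Conc
end HCIZ
namespace HCIZ
open MvPolynomial ProbabilityTheory

lemma integrable_pow_gauss (μ : ℝ) (v : NNReal) (m : ℕ) :
    Integrable (fun y : ℝ => y ^ m) (gaussianReal μ v) := by
  have := (memLp_id_gaussianReal (μ := μ) (v := v) m).integrable_norm_pow'
  rw [← integrable_norm_iff (by fun_prop)]
  simpa using this

lemma integrable_pow_gauss' (μ : ℝ) {v : NNReal} (hv : v ≠ 0) (m : ℕ) :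
    Integrable (fun y : ℝ => y ^ m * gaussianPDFReal μ v y) := by
  have := integrable_pow_gauss μ v m
  rw [gaussianReal_of_var_ne_zero _ hv, integrable_withDensity_iff (measurable_gaussianPDF _ _)
    (Filter.Eventually.of_forall fun _ => gaussianPDF_lt_top)] at this
  simpa [toReal_gaussianPDF] using this

lemma hasDerivAt_gauss (μ : ℝ) {v : NNReal} (hv : v ≠ 0) (y : ℝ) :
    HasDerivAt (gaussianPDFReal μ v) (- ((y - μ) / v) * gaussianPDFReal μ v y) y := by
  have hv' : (v : ℝ) ≠ 0 := by exact_mod_cast hv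
  rw [gaussianPDFReal_def]
  have h1 : HasDerivAt (fun x : ℝ => -(x - μ) ^ 2 / (2 * v)) (-((y - μ) / v)) y := by
    have := ((((hasDerivAt_id y).sub_const μ).pow 2).neg).div_const (2 * (v : ℝ))
    have e : (-((y - μ) / v) : ℝ) = -(((2 : ℕ) : ℝ) * (id y - μ) ^ (2 - 1) * 1) / (2 * v) := by
      simp; field_simp
    rw [e]
    exact this
  have := h1.exp.const_mul (√(2 * Real.pi * v))⁻¹
  have e : -((y - μ) / v) * ((√(2 * Real.pi * v))⁻¹ * Real.exp (-(y - μ) ^ 2 / (2 * v))) =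
    (√(2 * Real.pi * v))⁻¹ * (Real.exp (-(y - μ) ^ 2 / (2 * v)) * -((y - μ) / v)) := by ring
  simp only
  rw [e]
  exact this

lemma stein (μ : ℝ) {v : NNReal} (hv : v ≠ 0) (m : ℕ) :
    ∫ y, y ^ (m + 1 + 1) ∂gaussianReal μ v = μ * (∫ y, y ^ (m + 1) ∂gaussianReal μ v) +
      v * (m + 1) * (∫ y, y ^ m ∂gaussianReal μ v) := by
  have hv' : (v : ℝ) ≠ 0 := by exact_mod_cast hv
  have key := integral_mul_deriv_eq_deriv_mul_of_integrable
    (u := fun y : ℝ => y ^ (m + 1)) (v := gaussianPDFReal μ v)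
    (u' := fun y => (m + 1) * y ^ m) (v' := fun y => - ((y - μ) / v) * gaussianPDFReal μ v y)
    (fun x _ => by simpa using hasDerivAt_pow (m + 1) x) (fun x _ => hasDerivAt_gauss μ hv x)
    (by
      have := (((integrable_pow_gauss' μ hv (m + 2)).const_mul (-1 / (v : ℝ))).add
        ((integrable_pow_gauss' μ hv (m + 1)).const_mul (μ / v)))
      refine this.congr (Filter.Eventually.of_forall fun y => ?_)
      simp; field_simp; ring)
    (by
      have := (integrable_pow_gauss' μ hv m).const_mul ((m : ℝ) + 1)
      refine this.congr (Filter.Eventually.of_forall fun y => ?_)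
      simp; ring)
    (by
      refine (integrable_pow_gauss' μ hv (m + 1)).congr (Filter.Eventually.of_forall fun y => ?_)
      simp)
  simp only [integral_gaussianReal_eq_integral_smul hv, smul_eq_mul]
  have e1 : ∫ x, x ^ (m + 1) * (-((x - μ) / v) * gaussianPDFReal μ v x) =
      (-1 / (v : ℝ)) * (∫ x, gaussianPDFReal μ v x * x ^ (m + 1 + 1)) +
      (μ / v) * (∫ x, gaussianPDFReal μ v x * x ^ (m + 1)) := by
    rw [← integral_const_mul, ← integral_const_mul, ← integral_add]
    · refine integral_congr_ae (Filter.Eventually.of_forall fun y => ?_)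
      simp only; field_simp; ring
    · simpa [mul_comm] using (integrable_pow_gauss' μ hv (m + 2)).const_mul (-1 / (v : ℝ))
    · simpa [mul_comm] using (integrable_pow_gauss' μ hv (m + 1)).const_mul (μ / (v : ℝ))
  have e2 : ∫ x, (m + 1) * x ^ m * gaussianPDFReal μ v x =
      (m + 1) * ∫ x, gaussianPDFReal μ v x * x ^ m := by
    rw [← integral_const_mul]
    refine integral_congr_ae (Filter.Eventually.of_forall fun y => ?_)
    simp only; ring
  rw [e1, e2] at key
  field_simp at key
  linarith

lemma hq_eval (x : ℝ) {t v : NNReal} (ht : t ≠ 0) (hv : v ≠ 0) (m : ℕ) :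
    (hq ((v : ℝ) : ℂ) (x : ℂ) m).eval ((t : ℝ) : ℂ) =
      ((∫ y, y ^ m ∂gaussianReal x (t * v) : ℝ) : ℂ) := by
  have : (hq ((v : ℝ) : ℂ) (x : ℂ) m).eval ((t : ℝ) : ℂ) =
      ((∫ y, y ^ m ∂gaussianReal x (t * v) : ℝ) : ℂ) ∧
     (hq ((v : ℝ) : ℂ) (x : ℂ) (m + 1)).eval ((t : ℝ) : ℂ) =
      ((∫ y, y ^ (m + 1) ∂gaussianReal x (t * v) : ℝ) : ℂ) := by
    induction m with
    | zero => simp [hq, integral_id_gaussianReal]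
    | succ m ih =>
      refine ⟨ih.2, ?_⟩
      rw [stein x (mul_ne_zero ht hv), hq]
      simp only [Polynomial.eval_add, Polynomial.eval_mul, Polynomial.eval_C, Polynomial.eval_X,
        ih.1, ih.2]
      push_cast; ring
  exact this.1

section
variable {I : Type*} [Fintype I]

lemma pi_integrable (a : I → ℝ) (v : I → NNReal) (F : MvPolynomial I ℂ) :
    Integrable (fun x : I → ℝ => eval (fun i => (x i : ℂ)) F)
      (Measure.pi fun i => gaussianReal (a i) (v i)) := by
  induction F using MvPolynomial.induction_on' with
  | monomial m c =>
    simp only [eval_monomial]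
    refine Integrable.const_mul ?_ c
    simp only [Finsupp.prod_fintype _ _ (fun i => pow_zero _)]
    refine Integrable.fintype_prod (f := fun i (y : ℝ) => (y : ℂ) ^ m i) fun i => ?_
    have := (integrable_pow_gauss (a i) (v i) (m i)).ofReal (𝕜 := ℂ)
    simpa using this
  | add p q hp hq =>
    simp only [map_add]
    exact hp.add hq

lemma pi_eval (a : I → ℝ) {t : NNReal} (ht : t ≠ 0) (v : I → NNReal) (hv : ∀ i, v i ≠ 0)
    (F : MvPolynomial I ℂ) :
    ∫ x : I → ℝ, eval (fun i => (x i : ℂ)) F ∂(Measure.pi fun i => gaussianReal (a i) (t * v i)) =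
      (H (fun i => ((v i : ℝ) : ℂ)) (fun i => (a i : ℂ)) F).eval ((t : ℝ) : ℂ) := by
  induction F using MvPolynomial.induction_on' with
  | monomial m c =>
    simp only [eval_monomial, H_monomial]
    rw [integral_const_mul]
    simp only [Finsupp.prod_fintype _ _ (fun i => pow_zero _), Polynomial.eval_mul,
      Polynomial.eval_C, Polynomial.eval_prod]
    rw [integral_fintype_prod_eq_prod (f := fun i (y : ℝ) => (y : ℂ) ^ m i)]
    congr 1
    refine Finset.prod_congr rfl fun i _ => ?_
    rw [hq_eval _ ht (hv i), ← integral_complex_ofReal]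
    simp
  | add p q hp hq =>
    simp only [map_add, Polynomial.eval_add]
    rw [integral_add (pi_integrable _ _ _) (pi_integrable _ _ _), hp, hq]

lemma pi_density (a : I → ℝ) {t : NNReal} (ht : t ≠ 0) :
    (Measure.pi fun i => gaussianReal (a i) t) =
      (volume : Measure (I → ℝ)).withDensity
        (fun x => ENNReal.ofReal (∏ i, gaussianPDFReal (a i) t (x i))) := by
  apply Measure.pi_eq
  intro s hs
  rw [withDensity_apply _ (MeasurableSet.univ_pi hs), ← lintegral_indicator (MeasurableSet.univ_pi hs)]
  have e : ∀ x : I → ℝ, (Set.univ.pi s).indicator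
      (fun x => ENNReal.ofReal (∏ i, gaussianPDFReal (a i) t (x i))) x =
      ENNReal.ofReal (∏ i, (s i).indicator (gaussianPDFReal (a i) t) (x i)) := by
    intro x
    by_cases hx : x ∈ Set.univ.pi s
    · rw [Set.indicator_of_mem hx]
      congr 1
      refine Finset.prod_congr rfl fun i _ => ?_
      rw [Set.indicator_of_mem (hx i (Set.mem_univ i))]
    · rw [Set.indicator_of_notMem hx]
      simp only [Set.mem_univ_pi, not_forall] at hx
      obtain ⟨i, hi⟩ := hx
      rw [Finset.prod_eq_zero (Finset.mem_univ i) (Set.indicator_of_notMem hi _)]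
      simp
  simp only [e]
  rw [← ofReal_integral_eq_lintegral_ofReal]
  · rw [integral_fintype_prod_volume_eq_prod (f := fun i => (s i).indicator (gaussianPDFReal (a i) t)),
      ENNReal.ofReal_prod_of_nonneg]
    · refine Finset.prod_congr rfl fun i _ => ?_
      rw [gaussianReal_apply_eq_integral _ ht, integral_indicator (hs i)]
    · intro i _
      exact integral_nonneg fun y => Set.indicator_nonneg (fun _ _ => gaussianPDFReal_nonneg _ _ _) _
  · exact Integrable.fintype_prod (f := fun i => (s i).indicator (gaussianPDFReal (a i) t))
      fun i => (integrable_gaussianPDFReal _ _).indicator (hs i)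
  · exact Filter.Eventually.of_forall fun x => Finset.prod_nonneg fun i _ =>
      Set.indicator_nonneg (fun _ _ => gaussianPDFReal_nonneg _ _ _) _

lemma pi_exp_integrable (a : I → ℝ) (v : I → NNReal) (c : ℝ) :
    Integrable (fun x : I → ℝ => Real.exp (c * ∑ i, |x i|))
      (Measure.pi fun i => gaussianReal (a i) (v i)) := by
  simp only [Finset.mul_sum, Real.exp_sum]
  refine Integrable.fintype_prod (f := fun i (y : ℝ) => Real.exp (c * |y|)) fun i => ?_
  exact integrable_exp_mul_abs (integrable_exp_mul_gaussianReal c) (by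
    simpa using integrable_exp_mul_gaussianReal (-c))
end
end HCIZ
namespace HCIZ
open MvPolynomial ProbabilityTheory

lemma coords_shift {n : ℕ} (a e : HermParam n) (s : ℝ) (c : Idx n) :
    coords (a + s • e) c = coords a c + s * coords e c := by
  rcases c with c | c | c <;> simp [coords]

lemma paramMatrix_shift {n : ℕ} (a e : HermParam n) (s : ℝ) :
    paramMatrix (a + s • e) = paramMatrix a + (s : ℂ) • paramMatrix e := by
  ext i j
  simp only [paramMatrix, Matrix.of_apply, Matrix.add_apply, Matrix.smul_apply]
  split_ifs <;> simp [Complex.ext_iff]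
  ring

lemma exists_param {n : ℕ} {A : Matrix (Fin n) (Fin n) ℂ} (hA : A.IsHermitian) :
    ∃ a : HermParam n, A = paramMatrix a := by
  refine ⟨(fun i => (A i i).re, fun p => ((A p.1.1 p.1.2).re, (A p.1.1 p.1.2).im)), ?_⟩
  ext i j
  have h := hA.apply i j
  simp only [paramMatrix, Matrix.of_apply]
  split_ifs with h1 h2
  · rfl
  · rw [← h]; simp [Complex.ext_iff]
  · obtain rfl : i = j := le_antisymm (not_lt.1 h2) (not_lt.1 h1)
    rw [Complex.star_def, Complex.conj_eq_iff_re] at h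
    exact h.symm

lemma measurable_coords {n : ℕ} : Measurable (coords : HermParam n → Idx n → ℝ) := by
  rw [measurable_pi_iff]
  rintro (c | c | c) <;> simp only [coords, Sum.elim_inl, Sum.elim_inr] <;> fun_prop

instance {n : ℕ} : IsProbabilityMeasure (gueParamMeasure n) := by
  unfold gueParamMeasure; infer_instance

lemma law_coords (n : ℕ) : (gueParamMeasure n).map coords = Measure.pi fun c => gaussianReal 0 (vr n c) := by
  symm
  apply Measure.pi_eq
  intro s hs
  rw [Measure.map_apply measurable_coords (MeasurableSet.univ_pi hs)]
  have : coords ⁻¹' (Set.univ.pi s) = (Set.univ.pi fun i : Fin n => s (Sum.inl i)) ×ˢ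
      (Set.univ.pi fun p => s (Sum.inr (Sum.inl p)) ×ˢ s (Sum.inr (Sum.inr p))) := by
    ext e
    simp [coords, forall_and]
  rw [this, gueParamMeasure, Measure.prod_prod, Measure.pi_pi, Measure.pi_pi, Fintype.prod_sum_type,
    Fintype.prod_sum_type, ← Finset.prod_mul_distrib]
  simp only [Measure.prod_prod, vr, Sum.elim_inl, Sum.elim_inr]

lemma law_shift {n : ℕ} (a : HermParam n) (t : NNReal) :
    (gueParamMeasure n).map (fun e => coords (a + √(t : ℝ) • e)) =
      Measure.pi fun c => gaussianReal (coords a c) (t * vr n c) := by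
  have h1 : (fun e : HermParam n => coords (a + √(t : ℝ) • e)) =
      (fun (x : Idx n → ℝ) c => coords a c + √(t : ℝ) * x c) ∘ coords := by
    ext e c; simp [coords_shift]
  rw [h1, ← Measure.map_map (by fun_prop) measurable_coords, law_coords,
    Measure.pi_map_pi (f := fun c y => coords a c + √(t : ℝ) * y) (fun c => by fun_prop)]
  congr 1
  ext1 c
  have : (fun y => coords a c + √(t : ℝ) * y) = (fun y => coords a c + y) ∘ (fun y => √(t : ℝ) * y) := rfl
  rw [this, ← Measure.map_map (by fun_prop) (by fun_prop), gaussianReal_map_const_mul,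
    gaussianReal_map_const_add]
  congr 1
  · simp
  · congr 1
    ext; simp

lemma trace_pow_eig {n : ℕ} {M : Matrix (Fin n) (Fin n) ℂ} (hM : M.IsHermitian) (k : ℕ) :
    (M ^ k).trace = ∑ i, (hM.eigenvalues i : ℂ) ^ k := by
  conv_lhs => rw [hM.spectral_theorem]
  rw [← map_pow, Unitary.conjStarAlgAut_apply, Matrix.trace_mul_cycle, Matrix.diagonal_pow]
  simp [Matrix.trace]

lemma KK_eval {n : ℕ} (e : HermParam n) (hM : (paramMatrix e).IsHermitian)
    {x : MvPolynomial (Idx n) ℂ × MvPolynomial (Fin n) ℂ} (hx : x ∈ KK (GM n)) :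
    eval (fun c => (coords e c : ℂ)) x.1 = eval (fun i => (hM.eigenvalues i : ℂ)) x.2 := by
  induction hx using Algebra.adjoin_induction with
  | mem y hy =>
    obtain ⟨k, rfl⟩ := hy
    simp only [pp, map_sum, map_pow, eval_X]
    rw [← trace_pow_eig hM, ← eval_GM, ← Matrix.map_pow, AddMonoidHom.map_trace]
  | algebraMap c => simp [Prod.algebraMap_apply]
  | add y z _ _ hy hz => simp [hy, hz]
  | mul y z _ _ hy hz => simp [hy, hz]

lemma vc_eq (n : ℕ) : vc n = fun c => ((vr n c : ℝ) : ℂ) := by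
  ext c; rcases c with c | c <;> simp [vc, vr]

lemma moment {n : ℕ} {t : NNReal} (ht : t ≠ 0) (a : HermParam n)
    {x : MvPolynomial (Idx n) ℂ × MvPolynomial (Fin n) ℂ} (hx : x ∈ KK (GM n)) :
    eval (fun i => ((paramMatrix_isHermitian a).eigenvalues i : ℂ)) (VV n) *
      ∫ e, eval (fun i => ((paramMatrix_isHermitian (a + √(t : ℝ) • e)).eigenvalues i : ℂ)) x.2
        ∂(gueParamMeasure n) =
    ∫ y : Fin n → ℝ, eval (fun i => (y i : ℂ)) (VV n * x.2)
      ∂(Measure.pi fun i => gaussianReal ((paramMatrix_isHermitian a).eigenvalues i) t) := by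
  have h1 : ∀ e, eval (fun i => ((paramMatrix_isHermitian (a + √(t : ℝ) • e)).eigenvalues i : ℂ)) x.2 =
      eval (fun c => (coords (a + √(t : ℝ) • e) c : ℂ)) x.1 := fun e => (KK_eval _ _ hx).symm
  simp only [h1]
  have h2 := integral_map (μ := gueParamMeasure n) (φ := fun e => coords (a + √(t : ℝ) • e))
    (f := fun y : Idx n → ℝ => eval (fun c => (y c : ℂ)) x.1)
    (measurable_coords.comp (by fun_prop)).aemeasurable
    (by rw [law_shift]; exact (pi_integrable _ _ _).aestronglyMeasurable)
  rw [← h2, law_shift, pi_eval _ ht _ (by rintro (c | c) <;> simp [vr]), ← vc_eq]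
  have h3 := pi_eval (paramMatrix_isHermitian a).eigenvalues ht (fun _ => 1) (fun _ => one_ne_zero)
    (VV n * x.2)
  simp only [mul_one] at h3
  rw [h3]
  have h4 := H_eq (vc n) (fun c => (coords a c : ℂ)) (fun _ : Fin n => 1)
    (fun i => ((paramMatrix_isHermitian a).eigenvalues i : ℂ)) x.1 (VV n * x.2)
    (eval (fun i => ((paramMatrix_isHermitian a).eigenvalues i : ℂ)) (VV n)) (by
      intro k
      obtain ⟨f, hf, ef⟩ := KK_iter (GM n) (dd n) (dd_GM n) hx k
      have e1 : ⇑(Lap (vc n)) = DD (dd n) := funext fun F => Lap_eq_DD n F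
      have e2 : ⇑(Lap (fun _ : Fin n => 1)) = D0 n := funext fun F => Lap_eq_D0 n F
      rw [e1, e2, ef, map_mul, ← KK_eval a _ hf])
  have h5 := congrArg (Polynomial.eval ((t : ℝ) : ℂ)) h4
  rw [Polynomial.eval_mul, Polynomial.eval_C] at h5
  simpa using h5
end HCIZ
namespace HCIZ
open MvPolynomial ProbabilityTheory

lemma psum_mem (n k : ℕ) : psum (Fin n) ℂ k ∈ Algebra.adjoin ℂ (Set.range (pp n)) := by
  refine Algebra.subset_adjoin ⟨k, ?_⟩
  rw [pp, psum]

lemma esymm_mem (n k : ℕ) : esymm (Fin n) ℂ k ∈ Algebra.adjoin ℂ (Set.range (pp n)) := by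
  induction k using Nat.strong_induction_on with
  | _ k ih =>
    rcases Nat.eq_zero_or_pos k with rfl | hk
    · rw [esymm_zero]; exact Subalgebra.one_mem _
    · have h := mul_esymm_eq_sum (Fin n) ℂ k
      have h1 : (k : MvPolynomial (Fin n) ℂ) * esymm (Fin n) ℂ k ∈
          Algebra.adjoin ℂ (Set.range (pp n)) := by
        rw [h]
        refine Subalgebra.mul_mem _ (Subalgebra.pow_mem _ (Subalgebra.neg_mem _ (Subalgebra.one_mem _)) _)
          (Subalgebra.sum_mem _ fun a ha => ?_)
        exact Subalgebra.mul_mem _ (Subalgebra.mul_mem _ (Subalgebra.pow_mem _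
          (Subalgebra.neg_mem _ (Subalgebra.one_mem _)) _)
          (ih _ (Finset.mem_filter.1 ha).2)) (psum_mem n _)
      have h2 : esymm (Fin n) ℂ k = ((k : ℂ)⁻¹) • ((k : MvPolynomial (Fin n) ℂ) * esymm (Fin n) ℂ k) := by
        have : ((k : MvPolynomial (Fin n) ℂ)) = C (k : ℂ) := by simp
        rw [smul_eq_C_mul, this, ← mul_assoc, ← C_mul, inv_mul_cancel₀ (by exact_mod_cast hk.ne'), C_1, one_mul]
      rw [h2]
      exact Subalgebra.smul_mem _ h1 _

lemma symm_mem {n : ℕ} {f : MvPolynomial (Fin n) ℂ} (hf : f.IsSymmetric) :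
    f ∈ Algebra.adjoin ℂ (Set.range (pp n)) := by
  obtain ⟨p, hp⟩ := esymmAlgHom_surjective (σ := Fin n) (n := n) ℂ (by simp) ⟨f, hf⟩
  have h2 := esymmAlgHom_apply (σ := Fin n) p
  rw [hp] at h2
  simp only at h2
  rw [h2]
  clear hp h2
  induction p using MvPolynomial.induction_on with
  | C c => rw [aeval_C]; exact Subalgebra.algebraMap_mem _ _
  | add p q hp hq => rw [map_add]; exact Subalgebra.add_mem _ hp hq
  | mul_X p i hp => rw [map_mul, aeval_X]; exact Subalgebra.mul_mem _ hp (esymm_mem _ _)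

lemma symm_KK {n : ℕ} {f : MvPolynomial (Fin n) ℂ} (hf : f.IsSymmetric) :
    ∃ F, (F, f) ∈ KK (GM n) := by
  have h : (KK (GM n)).map (AlgHom.snd ℂ (MvPolynomial (Idx n) ℂ) (MvPolynomial (Fin n) ℂ)) =
      Algebra.adjoin ℂ (Set.range (pp n)) := by
    rw [KK, AlgHom.map_adjoin, gens, ← Set.range_comp]
    rfl
  have := symm_mem hf
  rw [← h] at this
  obtain ⟨x, hx, rfl⟩ := this
  exact ⟨x.1, hx⟩

lemma antitone_ext {m : ℕ} {u v : Fin m → ℝ} (hu : Antitone u) (hv : Antitone v)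
    (h : Finset.univ.val.map u = Finset.univ.val.map v) : u = v := by
  rw [Fin.univ_val_map, Fin.univ_val_map, Multiset.coe_eq_coe] at h
  exact List.ofFn_inj.1 (h.eq_of_sortedGE hu.sortedGE_ofFn hv.sortedGE_ofFn)

/-- vectors ordered in the way eigenvalues are -/
def SS (n : ℕ) : Set (Fin n → ℝ) :=
  {x | Antitone (fun i => x ((Fintype.equivOfCardEq (Fintype.card_fin _) :
    Fin (Fintype.card (Fin n)) ≃ Fin n) i))}

lemma SS_closed (n : ℕ) : IsClosed (SS n) := by
  simp only [SS, Antitone, Set.setOf_forall]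
  refine isClosed_iInter fun i => isClosed_iInter fun j => isClosed_iInter fun _ => ?_
  exact isClosed_le (by fun_prop) (by fun_prop)

lemma eig_SS {n : ℕ} {M : Matrix (Fin n) (Fin n) ℂ} (hM : M.IsHermitian) : hM.eigenvalues ∈ SS n := by
  intro i j hij
  simpa [Matrix.IsHermitian.eigenvalues] using hM.eigenvalues₀_antitone hij

/-- evaluation of monic polynomial with given roots at naturals -/
def evn (n : ℕ) (x : Fin n → ℝ) : ℕ → ℝ := fun k => ∏ i, ((k : ℝ) - x i)

lemma evn_inj (n : ℕ) : Set.InjOn (evn n) (SS n) := by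
  intro x hx y hy h
  have hp : (∏ i, (Polynomial.X - Polynomial.C (x i)) : Polynomial ℝ) =
      ∏ i, (Polynomial.X - Polynomial.C (y i)) := by
    apply Polynomial.eq_of_infinite_eval_eq
    refine Set.Infinite.mono (s := Set.range (fun k : ℕ => (k : ℝ))) ?_
      (Set.infinite_range_of_injective Nat.cast_injective)
    rintro _ ⟨k, rfl⟩
    have := congrFun h k
    simpa [evn, Polynomial.eval_prod] using this
  have hr : ∀ x : Fin n → ℝ, (∏ i, (Polynomial.X - Polynomial.C (x i)) : Polynomial ℝ).roots =
      Finset.univ.val.map x := by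
    intro x
    have := Polynomial.roots_multiset_prod_X_sub_C (Finset.univ.val.map x)
    rw [Multiset.map_map] at this
    exact this
  have h2 := congrArg Polynomial.roots hp
  rw [hr, hr] at h2
  have h3 := antitone_ext hx hy (by
    have : ∀ x : Fin n → ℝ, Finset.univ.val.map (fun i => x ((Fintype.equivOfCardEq (Fintype.card_fin _) :
      Fin (Fintype.card (Fin n)) ≃ Fin n) i)) = Finset.univ.val.map x := by
      intro x
      generalize (Fintype.equivOfCardEq (Fintype.card_fin _) :
        Fin (Fintype.card (Fin n)) ≃ Fin n) = e
      have h1 := congrArg Finset.val (Finset.map_univ_equiv e)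
      rw [Finset.map_val] at h1
      rw [← h1, Multiset.map_map]
      rfl
    rw [this, this, h2])
  ext i
  have := congrFun h3 ((Fintype.equivOfCardEq (Fintype.card_fin _) :
    Fin (Fintype.card (Fin n)) ≃ Fin n).symm i)
  simpa using this

lemma continuous_param (n : ℕ) : Continuous (paramMatrix : HermParam n → Matrix (Fin n) (Fin n) ℂ) := by
  refine continuous_matrix fun i j => ?_
  have h : ∀ e : HermParam n, paramMatrix e i j = eval (fun c => (coords e c : ℂ)) (GM n i j) := by
    intro e; rw [← eval_GM]; rfl
  simp only [h]
  have hc : ∀ c, Continuous fun e : HermParam n => coords e c := by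
    rintro (c | c | c) <;> simp only [coords, Sum.elim_inl, Sum.elim_inr] <;> fun_prop
  exact (MvPolynomial.continuous_eval (GM n i j)).comp
    (continuous_pi fun c => Complex.continuous_ofReal.comp (hc c))

lemma measurable_eig (n : ℕ) :
    Measurable (fun e : HermParam n => (paramMatrix_isHermitian e).eigenvalues) := by
  have hf : Continuous (evn n) := by unfold evn; fun_prop
  have h1 := hf.continuousOn.measurableEmbedding (SS_closed n).measurableSet (evn_inj n)
  have h2 : Measurable (fun e : HermParam n =>
      (⟨(paramMatrix_isHermitian e).eigenvalues, eig_SS _⟩ : SS n)) := by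
    rw [← h1.measurable_comp_iff]
    have h3 : ((SS n).domRestrict (evn n)) ∘ (fun e : HermParam n =>
      (⟨(paramMatrix_isHermitian e).eigenvalues, eig_SS _⟩ : SS n)) =
      fun (e : HermParam n) (k : ℕ) => ((paramMatrix e).charpoly.eval (k : ℂ)).re := by
      ext e k
      rw [(paramMatrix_isHermitian e).charpoly_eq]
      simp only [Function.comp, Set.domRestrict_apply, evn, Polynomial.eval_prod]
      simp only [Polynomial.eval_sub, Polynomial.eval_X, Polynomial.eval_C]
      have : ∏ i, ((k : ℂ) - ((paramMatrix_isHermitian e).eigenvalues i : ℂ)) =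
        ((∏ i, ((k : ℝ) - (paramMatrix_isHermitian e).eigenvalues i) : ℝ) : ℂ) := by push_cast; rfl
      exact (this ▸ Complex.ofReal_re _).symm
    rw [h3, measurable_pi_iff]
    intro k
    refine Continuous.measurable ?_
    simp only [Matrix.eval_charpoly]
    have := continuous_param n
    fun_prop
  exact measurable_subtype_coe.comp h2
end HCIZ
namespace HCIZ
open MvPolynomial ProbabilityTheory

lemma entry_bound {n : ℕ} (e : HermParam n) (i j : Fin n) :
    ‖paramMatrix e i j‖ ≤ 2 * ∑ c, |coords e c| := by
  have h : ∀ c, |coords e c| ≤ ∑ c, |coords e c| := fun c =>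
    Finset.single_le_sum (f := fun c => |coords e c|) (fun _ _ => abs_nonneg _) (Finset.mem_univ c)
  have h0 : 0 ≤ ∑ c, |coords e c| := Finset.sum_nonneg fun _ _ => abs_nonneg _
  refine (Complex.norm_le_abs_re_add_abs_im _).trans ?_
  simp only [paramMatrix, Matrix.of_apply]
  split_ifs with h1 h2
  · have := h (Sum.inr (Sum.inl ⟨(i, j), h1⟩))
    have := h (Sum.inr (Sum.inr ⟨(i, j), h1⟩))
    simp only [coords, Sum.elim_inl, Sum.elim_inr] at *
    linarith
  · have := h (Sum.inr (Sum.inl ⟨(j, i), h2⟩))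
    have := h (Sum.inr (Sum.inr ⟨(j, i), h2⟩))
    simp only [coords, Sum.elim_inl, Sum.elim_inr, abs_neg] at *
    linarith
  · have := h (Sum.inl i)
    simp only [coords, Sum.elim_inl, Complex.ofReal_re, Complex.ofReal_im, abs_zero] at *
    linarith

lemma eig_bound {n : ℕ} (e : HermParam n) (i : Fin n) :
    |(paramMatrix_isHermitian e).eigenvalues i| ≤ n * (2 * ∑ c, |coords e c|) := by
  set hM := paramMatrix_isHermitian e
  have h1 : Module.End.HasEigenvalue (Matrix.toLin' (paramMatrix e)) ((hM.eigenvalues i : ℝ) : ℂ) := by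
    refine Module.End.hasEigenvalue_of_hasEigenvector (x := (hM.eigenvectorBasis i).ofLp) ⟨?_, ?_⟩
    · rw [Module.End.mem_eigenspace_iff, Matrix.toLin'_apply, hM.mulVec_eigenvectorBasis i]
      ext j; simp
    · intro h
      apply hM.eigenvectorBasis.toBasis.ne_zero i
      ext j
      simpa using congrFun h j
  obtain ⟨k, hk⟩ := eigenvalue_mem_ball h1
  rw [Metric.mem_closedBall, dist_eq_norm] at hk
  have h2 : ‖((hM.eigenvalues i : ℝ) : ℂ)‖ ≤ ∑ j, ‖paramMatrix e k j‖ := by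
    rw [← Finset.add_sum_erase _ _ (Finset.mem_univ k)]
    have := norm_sub_norm_le ((hM.eigenvalues i : ℝ) : ℂ) (paramMatrix e k k)
    linarith
  rw [Complex.norm_real, Real.norm_eq_abs] at h2
  refine h2.trans ((Finset.sum_le_sum fun j _ => entry_bound e k j).trans ?_)
  simp

/-- eigenvalue map -/
def eg {n : ℕ} (a : HermParam n) (t : NNReal) (e : HermParam n) : Fin n → ℝ :=
  (paramMatrix_isHermitian (a + √(t : ℝ) • e)).eigenvalues

lemma measurable_eg {n : ℕ} (a : HermParam n) (t : NNReal) : Measurable (eg a t) :=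
  (measurable_eig n).comp (by fun_prop)

lemma eg_exp_integrable {n : ℕ} (a : HermParam n) (t : NNReal) {c : ℝ} (hc : 0 ≤ c) :
    Integrable (fun e => Real.exp (c * ∑ i, |eg a t e i|)) (gueParamMeasure n) := by
  have h := pi_exp_integrable (coords a) (fun i => t * vr n i) (c * (n * (n * 2)))
  rw [← law_shift] at h
  have hm : Measurable (fun e => coords (a + √(t : ℝ) • e)) := measurable_coords.comp (by fun_prop)
  have h2 := h.comp_measurable hm
  refine h2.mono' ?_ (Filter.Eventually.of_forall fun e => ?_)
  · have := measurable_eg a t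
    exact Measurable.aestronglyMeasurable (by fun_prop)
  · rw [Real.norm_eq_abs, Real.abs_exp, Function.comp, Real.exp_le_exp, mul_assoc]
    refine mul_le_mul_of_nonneg_left ?_ hc
    refine (Finset.sum_le_sum fun i _ => eig_bound _ i).trans ?_
    simp [mul_assoc]

end HCIZ
namespace HCIZ
open MvPolynomial ProbabilityTheory

/-- symmetrized power of linear form -/
def fk {n : ℕ} (ξ : Fin n → ℝ) (k : ℕ) : MvPolynomial (Fin n) ℂ :=
  ∑ σ : Equiv.Perm (Fin n), rename σ ((∑ i, C (ξ i : ℂ) * X i) ^ k)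

lemma fk_symm {n : ℕ} (ξ : Fin n → ℝ) (k : ℕ) : (fk ξ k).IsSymmetric := by
  intro τ
  simp only [fk, map_sum, rename_rename]
  exact Fintype.sum_equiv (Equiv.mulLeft τ) _ _ (fun σ => rfl)

lemma fk_eval {n : ℕ} (ξ : Fin n → ℝ) (k : ℕ) (x : Fin n → ℝ) :
    eval (fun i => (x i : ℂ)) (fk ξ k) = ∑ σ : Equiv.Perm (Fin n), ((∑ i, ξ i * x (σ i) : ℝ) : ℂ) ^ k := by
  simp [fk, map_sum]

/-- symmetrized exponential -/
def Sx {n : ℕ} (ξ : Fin n → ℝ) (x : Fin n → ℝ) : ℂ :=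
  ∑ σ : Equiv.Perm (Fin n), Complex.exp ((∑ i, ξ i * x (σ i) : ℝ) * Complex.I)

lemma lin_bound {n : ℕ} (ξ x : Fin n → ℝ) (σ : Equiv.Perm (Fin n)) :
    |∑ i, ξ i * x (σ i)| ≤ (∑ i, |ξ i|) * ∑ i, |x i| := by
  refine (Finset.abs_sum_le_sum_abs _ _).trans ?_
  rw [Finset.sum_mul]
  refine Finset.sum_le_sum fun i _ => ?_
  rw [abs_mul]
  exact mul_le_mul_of_nonneg_left (Finset.single_le_sum (f := fun i => |x i|)
    (fun _ _ => abs_nonneg _) (Finset.mem_univ _)) (abs_nonneg _)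

lemma hasSum_moments {n : ℕ} {Ω : Type*} [MeasurableSpace Ω] (μ : Measure Ω) (y : Ω → Fin n → ℝ)
    (hy : Measurable y) (w : Ω → ℂ) (hw : Measurable w) (ξ : Fin n → ℝ)
    (hi : ∀ c : ℝ, 0 ≤ c → Integrable (fun e => ‖w e‖ * Real.exp (c * ∑ i, |y e i|)) μ) :
    HasSum (fun k : ℕ => Complex.I ^ k / (k.factorial : ℂ) *
      ∫ e, w e * eval (fun i => (y e i : ℂ)) (fk ξ k) ∂μ) (∫ e, w e * Sx ξ (y e) ∂μ) := by
  set K : ℝ := ∑ i, |ξ i|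
  have hK : 0 ≤ K := Finset.sum_nonneg fun _ _ => abs_nonneg _
  set N : ℝ := (Fintype.card (Equiv.Perm (Fin n)) : ℝ)
  have hsum : ∀ e, HasSum (fun k : ℕ => ‖w e‖ * N * ((K * ∑ i, |y e i|) ^ k / k.factorial))
      (‖w e‖ * N * Real.exp (K * ∑ i, |y e i|)) := by
    intro e
    refine HasSum.mul_left _ ?_
    rw [Real.exp_eq_exp_ℝ]
    exact NormedSpace.expSeries_div_hasSum_exp _
  simp only [← integral_const_mul]
  refine hasSum_integral_of_dominated_convergence
    (fun k e => ‖w e‖ * N * ((K * ∑ i, |y e i|) ^ k / k.factorial)) ?_ ?_ ?_ ?_ ?_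
  · intro k
    simp only [fk_eval]
    exact Measurable.aestronglyMeasurable (by fun_prop)
  · intro k
    refine Filter.Eventually.of_forall fun e => ?_
    rw [fk_eval, norm_mul, norm_mul, norm_div, norm_pow, Complex.norm_I, one_pow, Complex.norm_natCast]
    have h : ‖∑ σ : Equiv.Perm (Fin n), ((∑ i, ξ i * y e (σ i) : ℝ) : ℂ) ^ k‖ ≤
        N * (K * ∑ i, |y e i|) ^ k := by
      refine (norm_sum_le _ _).trans ((Finset.sum_le_sum fun σ _ =>
        (?_ : _ ≤ (K * ∑ i, |y e i|) ^ k)).trans (by simp [N]))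
      rw [norm_pow, Complex.norm_real, Real.norm_eq_abs]
      exact pow_le_pow_left₀ (abs_nonneg _) (lin_bound ξ (y e) σ) k
    calc _ ≤ 1 / (k.factorial : ℝ) * (‖w e‖ * (N * (K * ∑ i, |y e i|) ^ k)) := by gcongr
      _ = _ := by ring
  · exact Filter.Eventually.of_forall fun e => (hsum e).summable
  · simp only [(hsum _).tsum_eq]
    have := (hi K hK).const_mul N
    refine this.congr (Filter.Eventually.of_forall fun e => ?_)
    simp only; ring
  · refine Filter.Eventually.of_forall fun e => ?_
    have : ∀ σ : Equiv.Perm (Fin n), HasSum (fun k : ℕ =>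
        w e * ((((∑ i, ξ i * y e (σ i) : ℝ) : ℂ) * Complex.I) ^ k / k.factorial))
        (w e * Complex.exp ((∑ i, ξ i * y e (σ i) : ℝ) * Complex.I)) := by
      intro σ
      refine HasSum.mul_left _ ?_
      rw [Complex.exp_eq_exp_ℂ]
      exact NormedSpace.expSeries_div_hasSum_exp _
    have h2 := hasSum_sum (s := Finset.univ) fun σ _ => this σ
    rw [← Finset.mul_sum] at h2
    refine (congrArg (fun f => HasSum f _) (funext fun k => ?_)).mpr h2
    rw [fk_eval, Finset.mul_sum, Finset.mul_sum]
    refine Finset.sum_congr rfl fun σ _ => ?_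
    rw [mul_pow]; ring

lemma VV_exp_integrable {n : ℕ} (a : Fin n → ℝ) (t : NNReal) (c : ℝ) :
    Integrable (fun x : Fin n → ℝ => ‖eval (fun i => (x i : ℂ)) (VV n)‖ * Real.exp (c * ∑ i, |x i|))
      (Measure.pi fun i => gaussianReal (a i) t) := by
  have h1 := (pi_integrable a (fun _ => t) (VV n * VV n)).norm
  have h2 := pi_exp_integrable a (fun _ => t) (2 * c)
  refine (h1.add h2).mono' ?_ (Filter.Eventually.of_forall fun x => ?_)
  · refine Continuous.aestronglyMeasurable ?_
    have : Continuous fun x : Fin n → ℝ => eval (fun i => (x i : ℂ)) (VV n) :=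
      (MvPolynomial.continuous_eval (VV n)).comp (by fun_prop)
    fun_prop
  · simp only [Pi.add_apply, map_mul, norm_mul, Real.norm_eq_abs, Real.abs_exp, abs_norm]
    rw [show 2 * c * ∑ i, |x i| = c * ∑ i, |x i| + c * ∑ i, |x i| by ring, Real.exp_add]
    nlinarith [sq_nonneg (‖eval (fun i => (x i : ℂ)) (VV n)‖ - Real.exp (c * ∑ i, |x i|)),
      sq_nonneg (‖eval (fun i => (x i : ℂ)) (VV n)‖), sq_nonneg (Real.exp (c * ∑ i, |x i|))]

lemma cf_identity {n : ℕ} {t : NNReal} (ht : t ≠ 0) (a : HermParam n) (ξ : Fin n → ℝ) :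
    eval (fun i => ((paramMatrix_isHermitian a).eigenvalues i : ℂ)) (VV n) *
      ∫ e, Sx ξ (eg a t e) ∂(gueParamMeasure n) =
    ∫ y : Fin n → ℝ, eval (fun i => (y i : ℂ)) (VV n) * Sx ξ y
      ∂(Measure.pi fun i => gaussianReal ((paramMatrix_isHermitian a).eigenvalues i) t) := by
  have h1 := hasSum_moments (gueParamMeasure n) (eg a t) (measurable_eg a t) (fun _ => 1)
    measurable_const ξ (fun c hc => by simpa using eg_exp_integrable a t hc)
  have h2 := hasSum_moments
    (Measure.pi fun i => gaussianReal ((paramMatrix_isHermitian a).eigenvalues i) t) id measurable_id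
    (fun y => eval (fun i => (y i : ℂ)) (VV n))
    (Continuous.measurable ((MvPolynomial.continuous_eval (VV n)).comp (by fun_prop))) ξ
    (fun c _ => VV_exp_integrable _ t c)
  have h3 := h1.mul_left (eval (fun i => ((paramMatrix_isHermitian a).eigenvalues i : ℂ)) (VV n))
  simp only [one_mul, id] at h2 h3
  refine h3.unique ?_
  refine (congrArg (fun f => HasSum f _) (funext fun k => ?_)).mpr h2
  obtain ⟨F, hF⟩ := symm_KK (fk_symm ξ k)
  have := moment ht a hF
  simp only [map_mul] at this
  rw [← this]
  simp only [eg]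
  ring

end HCIZ
namespace HCIZ
open MvPolynomial ProbabilityTheory

lemma meas_eq {n : ℕ} (ν : Measure (Fin n → ℝ)) [IsFiniteMeasure ν] (ρ : (Fin n → ℝ) → ℝ)
    (hρ : Measurable ρ) (hi : Integrable ρ volume)
    (h : ∀ L : StrongDual ℝ (Fin n → ℝ), ∫ x, Complex.exp (L x * Complex.I) ∂ν =
      ∫ x, (ρ x : ℂ) * Complex.exp (L x * Complex.I)) :
    ν = volume.withDensity (fun x => ENNReal.ofReal (ρ x)) := by
  have f1 : IsFiniteMeasure ((volume : Measure (Fin n → ℝ)).withDensity (fun x => ENNReal.ofReal (ρ x))) :=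
    isFiniteMeasure_withDensity_ofReal hi.2
  have f2 : IsFiniteMeasure ((volume : Measure (Fin n → ℝ)).withDensity (fun x => ENNReal.ofReal (- ρ x))) :=
    isFiniteMeasure_withDensity_ofReal hi.neg.2
  have hb : ∀ (L : StrongDual ℝ (Fin n → ℝ)) (μ : Measure (Fin n → ℝ)) [IsFiniteMeasure μ],
      Integrable (fun x => Complex.exp (L x * Complex.I)) μ := by
    intro L μ _
    refine Integrable.of_bound (C := 1) ?_ (Filter.Eventually.of_forall fun x => ?_)
    · exact Continuous.aestronglyMeasurable (by fun_prop)
    · rw [Complex.norm_exp_ofReal_mul_I]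
  have key : ν + volume.withDensity (fun x => ENNReal.ofReal (- ρ x)) =
      volume.withDensity (fun x => ENNReal.ofReal (ρ x)) := by
    apply Measure.ext_of_charFunDual
    ext L
    rw [charFunDual_apply, charFunDual_apply, integral_add_measure (hb L _) (hb L _), h L]
    rw [integral_withDensity_eq_integral_toReal_smul (by fun_prop) (by simp),
      integral_withDensity_eq_integral_toReal_smul (by fun_prop) (by simp), ← integral_add]
    · congr 1
      ext x
      rcases le_total 0 (ρ x) with hx | hx
      · rw [ENNReal.toReal_ofReal hx, ENNReal.ofReal_of_nonpos (by linarith)]; simp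
      · rw [ENNReal.toReal_ofReal (by linarith), ENNReal.ofReal_of_nonpos hx]; simp
    · have := hi.ofReal (𝕜 := ℂ)
      refine this.norm.mono' ?_ (Filter.Eventually.of_forall fun x => ?_)
      · exact Measurable.aestronglyMeasurable (by fun_prop)
      · rw [norm_mul, Complex.norm_exp_ofReal_mul_I, mul_one]; exact le_rfl
    · have := hb L (volume.withDensity (fun x => ENNReal.ofReal (- ρ x)))
      rwa [integrable_withDensity_iff_integrable_smul' (by fun_prop) (by simp)] at this
  have hneg : volume.withDensity (fun x => ENNReal.ofReal (- ρ x)) = 0 := by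
    have hS : MeasurableSet {x | ρ x < 0} := measurableSet_lt hρ measurable_const
    have h1 := congrArg (fun μ => μ {x | ρ x < 0}) key
    simp only [Measure.add_apply, withDensity_apply _ hS] at h1
    have h2 : ∫⁻ x in {x | ρ x < 0}, ENNReal.ofReal (ρ x) = 0 := by
      rw [setLIntegral_congr_fun (g := fun _ => 0) hS]
      · simp
      · intro x hx
        exact ENNReal.ofReal_of_nonpos (le_of_lt hx)
    rw [h2, add_eq_zero] at h1
    have h3 := h1.2
    rw [← Measure.measure_univ_eq_zero, withDensity_apply _ MeasurableSet.univ, Measure.restrict_univ,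
      ← lintegral_add_compl _ hS, h3, zero_add]
    rw [setLIntegral_congr_fun (g := fun _ => 0) hS.compl]
    · simp
    · intro x hx
      exact ENNReal.ofReal_of_nonpos (by simpa using hx)
  rw [hneg, add_zero] at key
  exact key

lemma pi_density_int {n : ℕ} (a : Fin n → ℝ) {t : NNReal} (ht : t ≠ 0) (f : (Fin n → ℝ) → ℂ) :
    ∫ x, f x ∂(Measure.pi fun i => gaussianReal (a i) t) =
      ∫ x, ((∏ i, gaussianPDFReal (a i) t (x i) : ℝ) : ℂ) * f x := by
  rw [pi_density a ht, integral_withDensity_eq_integral_toReal_smul (by fun_prop) (by simp)]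
  congr 1
  ext x
  rw [ENNReal.toReal_ofReal (Finset.prod_nonneg fun i _ => gaussianPDFReal_nonneg _ _ _)]
  simp

lemma pi_density_integrable {n : ℕ} (a : Fin n → ℝ) {t : NNReal} (ht : t ≠ 0) {f : (Fin n → ℝ) → ℂ}
    (hf : Integrable f (Measure.pi fun i => gaussianReal (a i) t)) :
    Integrable fun x => ((∏ i, gaussianPDFReal (a i) t (x i) : ℝ) : ℂ) * f x := by
  rw [pi_density a ht, integrable_withDensity_iff_integrable_smul' (by fun_prop) (by simp)] at hf
  refine hf.congr (Filter.Eventually.of_forall fun x => ?_)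
  simp only
  rw [ENNReal.toReal_ofReal (Finset.prod_nonneg fun i _ => gaussianPDFReal_nonneg _ _ _)]
  simp

lemma VV_real {n : ℕ} (x : Fin n → ℝ) :
    eval (fun i => (x i : ℂ)) (VV n) = ((Matrix.vandermonde x).det : ℂ) := by
  rw [VV, RingHom.map_det, ← Complex.ofRealHom_eq_coe, RingHom.map_det]
  congr 1
  ext i j
  simp [Matrix.vandermonde]

lemma vdm_perm {n : ℕ} (x : Fin n → ℝ) (σ : Equiv.Perm (Fin n)) :
    (Matrix.vandermonde (x ∘ σ)).det = (Equiv.Perm.sign σ : ℝ) * (Matrix.vandermonde x).det := by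
  rw [← Matrix.det_permute σ]
  rfl

/-- the unnormalized density -/
def dens {n : ℕ} (a : Fin n → ℝ) (t : NNReal) (x : Fin n → ℝ) : ℝ :=
  (Matrix.of fun i j : Fin n => gaussianPDFReal (a j) t (x i)).det * (Matrix.vandermonde x).det

lemma dens_eq {n : ℕ} (a : Fin n → ℝ) (t : NNReal) (x : Fin n → ℝ) : dens a t x =
    ∑ σ : Equiv.Perm (Fin n), (∏ i, gaussianPDFReal (a i) t ((x ∘ σ.symm) i)) *
      (Matrix.vandermonde (x ∘ σ.symm)).det := by
  rw [dens, Matrix.det_apply', Finset.sum_mul]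
  refine Fintype.sum_equiv (Equiv.inv _) _ _ fun σ => ?_
  simp only [Equiv.inv_apply, vdm_perm, Matrix.of_apply]
  simp [Equiv.Perm.inv_def]
  ring

end HCIZ
namespace HCIZ
open MvPolynomial ProbabilityTheory

lemma perm_mp {n : ℕ} (σ : Equiv.Perm (Fin n)) :
    MeasurePreserving (fun x : Fin n → ℝ => x ∘ σ) volume volume := by
  have h := volume_measurePreserving_piCongrLeft (fun _ : Fin n => ℝ) σ.symm
  have h2 : (fun x : Fin n → ℝ => x ∘ σ) =
      (MeasurableEquiv.piCongrLeft (fun _ : Fin n => ℝ) σ.symm : (Fin n → ℝ) → (Fin n → ℝ)) := by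
    ext x i
    rw [MeasurableEquiv.coe_piCongrLeft]
    have := Equiv.piCongrLeft_apply_apply (fun _ : Fin n => ℝ) σ.symm x (σ i)
    rw [Equiv.symm_apply_apply] at this
    exact this.symm
  rw [h2]
  exact h

/-- one term of the permutation expansion -/
def FF {n : ℕ} (a : Fin n → ℝ) (t : NNReal) (L : StrongDual ℝ (Fin n → ℝ)) (σ : Equiv.Perm (Fin n))
    (x : Fin n → ℝ) : ℂ :=
  ((∏ i, gaussianPDFReal (a i) t (x i) : ℝ) : ℂ) *
    (((Matrix.vandermonde x).det : ℂ) * Complex.exp (L (x ∘ σ) * Complex.I))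

lemma continuous_vdm (n : ℕ) : Continuous fun x : Fin n → ℝ => (Matrix.vandermonde x).det := by
  refine Continuous.matrix_det (continuous_matrix fun i j => ?_)
  simp only [Matrix.vandermonde_apply]
  fun_prop

lemma int_aux {n : ℕ} (a : Fin n → ℝ) (t : NNReal) (L : StrongDual ℝ (Fin n → ℝ))
    (σ : Equiv.Perm (Fin n)) : Integrable (fun x : Fin n → ℝ => ((Matrix.vandermonde x).det : ℂ) *
      Complex.exp (L (x ∘ σ) * Complex.I)) (Measure.pi fun i => gaussianReal (a i) t) := by
  have h := pi_integrable a (fun _ => t) (VV n)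
  simp only [VV_real] at h
  have hc := continuous_vdm n
  refine h.norm.mono' ?_ (Filter.Eventually.of_forall fun x => ?_)
  · refine Continuous.aestronglyMeasurable ?_
    have : Continuous fun x : Fin n → ℝ => x ∘ σ := by fun_prop
    fun_prop
  · rw [norm_mul, Complex.norm_exp_ofReal_mul_I, mul_one]

lemma FF_int {n : ℕ} (a : Fin n → ℝ) {t : NNReal} (ht : t ≠ 0) (L : StrongDual ℝ (Fin n → ℝ))
    (σ : Equiv.Perm (Fin n)) : Integrable (FF a t L σ) :=
  pi_density_integrable a ht (int_aux a t L σ)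

lemma FF_perm {n : ℕ} (a : Fin n → ℝ) {t : NNReal} (ht : t ≠ 0) (L : StrongDual ℝ (Fin n → ℝ))
    (σ : Equiv.Perm (Fin n)) : ∫ x, FF a t L σ (x ∘ σ.symm) = ∫ x, FF a t L σ x := by
  have h := (FF_int a ht L σ).aestronglyMeasurable
  have h2 := perm_mp σ.symm
  rw [← h2.map_eq] at h
  have h3 := integral_map h2.measurable.aemeasurable h
  rw [← h3, h2.map_eq]

lemma dens_FF {n : ℕ} (a : Fin n → ℝ) (t : NNReal) (L : StrongDual ℝ (Fin n → ℝ)) (x : Fin n → ℝ) :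
    (dens a t x : ℂ) * Complex.exp (L x * Complex.I) =
      ∑ σ : Equiv.Perm (Fin n), FF a t L σ (x ∘ σ.symm) := by
  rw [dens_eq, Complex.ofReal_sum, Finset.sum_mul]
  refine Finset.sum_congr rfl fun σ _ => ?_
  have : (x ∘ σ.symm) ∘ σ = x := by ext i; simp
  rw [FF, this, Complex.ofReal_mul, mul_assoc]

lemma dens_cf {n : ℕ} (a : Fin n → ℝ) {t : NNReal} (ht : t ≠ 0) (L : StrongDual ℝ (Fin n → ℝ)) :
    ∫ x, (dens a t x : ℂ) * Complex.exp (L x * Complex.I) =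
      ∫ x, ((Matrix.vandermonde x).det : ℂ) *
        ∑ σ : Equiv.Perm (Fin n), Complex.exp (L (x ∘ σ) * Complex.I)
        ∂(Measure.pi fun i => gaussianReal (a i) t) := by
  simp only [dens_FF, Finset.mul_sum]
  have h0 : ∀ σ ∈ (Finset.univ : Finset (Equiv.Perm (Fin n))),
      Integrable (fun x => FF a t L σ (x ∘ σ.symm)) := fun σ _ =>
    (perm_mp σ.symm).integrable_comp_of_integrable (FF_int a ht L σ)
  rw [integral_finsetSum _ h0,
    integral_finsetSum _ fun σ _ => int_aux a t L σ]
  refine Finset.sum_congr rfl fun σ _ => ?_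
  rw [pi_density_int a ht]
  exact FF_perm a ht L σ

lemma dens_integrable {n : ℕ} (a : Fin n → ℝ) {t : NNReal} (ht : t ≠ 0) : Integrable (dens a t) := by
  have h : Integrable fun x => (dens a t x : ℂ) := by
    have h1 : (fun x => (dens a t x : ℂ)) = fun x => ∑ σ : Equiv.Perm (Fin n), FF a t 0 σ (x ∘ σ.symm) := by
      ext x; rw [← dens_FF]; simp
    rw [h1]
    exact integrable_finsetSum _ fun σ _ =>
      (perm_mp σ.symm).integrable_comp_of_integrable (FF_int a ht 0 σ)
  simpa using h.re

lemma measurable_dens {n : ℕ} (a : Fin n → ℝ) (t : NNReal) : Measurable (dens a t) := by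
  refine Measurable.mul ?_ (continuous_vdm n).measurable
  simp only [Matrix.det_apply', Matrix.of_apply]
  fun_prop

lemma L_eq {n : ℕ} (L : StrongDual ℝ (Fin n → ℝ)) (x : Fin n → ℝ) :
    L x = ∑ i, L (Pi.single i 1) * x i := by
  conv_lhs => rw [pi_eq_sum_univ' x]
  simp [map_sum, mul_comm]

lemma law {n : ℕ} {t : NNReal} (ht : t ≠ 0) (a : HermParam n)
    (hdist : Function.Injective (paramMatrix_isHermitian a).eigenvalues) :
    (∑ σ : Equiv.Perm (Fin n), (gueParamMeasure n).map (fun e => eg a t e ∘ σ)) =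
    volume.withDensity (fun x => ENNReal.ofReal (dens (paramMatrix_isHermitian a).eigenvalues t x /
      (Matrix.vandermonde (paramMatrix_isHermitian a).eigenvalues).det)) := by
  have hm : ∀ σ : Equiv.Perm (Fin n), Measurable (fun e => eg a t e ∘ σ) := by
    intro σ
    exact (perm_mp σ).measurable.comp (measurable_eg a t)
  have hV : (Matrix.vandermonde (paramMatrix_isHermitian a).eigenvalues).det ≠ 0 :=
    Matrix.det_vandermonde_ne_zero_iff.2 hdist
  have hfin : ∀ σ : Equiv.Perm (Fin n), IsProbabilityMeasure
      ((gueParamMeasure n).map (fun e => eg a t e ∘ σ)) := fun σ =>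
    Measure.isProbabilityMeasure_map (hm σ).aemeasurable
  have hi : ∀ (L : StrongDual ℝ (Fin n → ℝ)) (μ : Measure (Fin n → ℝ)) [IsFiniteMeasure μ],
      Integrable (fun x => Complex.exp (L x * Complex.I)) μ := by
    intro L μ _
    refine Integrable.of_bound (C := 1) ?_ (Filter.Eventually.of_forall fun x => ?_)
    · exact Continuous.aestronglyMeasurable (by fun_prop)
    · rw [Complex.norm_exp_ofReal_mul_I]
  apply meas_eq
  · exact (measurable_dens _ _).div_const _
  · exact (dens_integrable _ ht).div_const _
  · intro L
    rw [integral_finsetSum_measure fun σ _ => hi L _]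
    have h1 : ∀ σ : Equiv.Perm (Fin n), ∫ x, Complex.exp (L x * Complex.I)
        ∂((gueParamMeasure n).map (fun e => eg a t e ∘ σ)) =
        ∫ e, Complex.exp (L (eg a t e ∘ σ) * Complex.I) ∂(gueParamMeasure n) := by
      intro σ
      exact integral_map (hm σ).aemeasurable (hi L _).aestronglyMeasurable
    simp only [h1]
    rw [← integral_finsetSum]
    · have h2 := cf_identity ht a (fun i => L (Pi.single i 1))
      have h3 : ∀ x, Sx (fun i => L (Pi.single i 1)) x =
          ∑ σ : Equiv.Perm (Fin n), Complex.exp (L (x ∘ σ) * Complex.I) := by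
        intro x
        rw [Sx]
        refine Finset.sum_congr rfl fun σ _ => ?_
        rw [L_eq L (x ∘ σ)]
        rfl
      simp only [h3, VV_real] at h2
      rw [← dens_cf _ ht] at h2
      have h4 : ((Matrix.vandermonde (paramMatrix_isHermitian a).eigenvalues).det : ℂ) ≠ 0 := by
        exact_mod_cast hV
      rw [← mul_right_inj' h4, h2, ← integral_const_mul]
      congr 1
      ext x
      rw [Complex.ofReal_div]
      field_simp
    · intro σ _
      exact (hi L ((gueParamMeasure n).map (fun e => eg a t e ∘ σ))).comp_measurable (hm σ)

end HCIZ
/-- Harish-Chandra/Itzykson–Zuber consequence: if `A` is Hermitian with distinct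
eigenvalues `a_1,…,a_n` and `Y` is drawn from the GUE, then for `t > 0` the
eigenvalue density of `A + √t Y` is
`(1/(n! (2πt)^{n/2})) · det[e^{-(x_i-a_j)²/(2t)}] · det[x_i^{j-1}]/det[a_i^{j-1}]`,
expressed here by integrating an arbitrary symmetric measurable test function
against the eigenvalues. -/
theorem stmt19 (n : ℕ) (t : ℝ) (ht : 0 < t) (A : Matrix (Fin n) (Fin n) ℂ)
    (hA : A.IsHermitian) (hdist : Function.Injective hA.eigenvalues)
    (g : (Fin n → ℝ) → ℝ≥0∞) (hg : Measurable g)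
    (hsymm : ∀ (σ : Equiv.Perm (Fin n)) (x : Fin n → ℝ), g (x ∘ σ) = g x) :
    (∫⁻ e, g ((shift_isHermitian hA t e).eigenvalues) ∂(gueParamMeasure n)) =
      ∫⁻ x : Fin n → ℝ, g x * ENNReal.ofReal
        ((1 / ((n.factorial : ℝ) * (2 * Real.pi * t) ^ ((n : ℝ) / 2))) *
          (Matrix.of fun i j : Fin n =>
            Real.exp (-(x i - hA.eigenvalues j) ^ 2 / (2 * t))).det *
          (Matrix.vandermonde x).det / (Matrix.vandermonde hA.eigenvalues).det) := by
  obtain ⟨a, rfl⟩ := HCIZ.exists_param hA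
  set T : NNReal := ⟨t, ht.le⟩ with hT
  have hTt : (T : ℝ) = t := rfl
  have hT0 : T ≠ 0 := by
    intro h
    have := congrArg NNReal.toReal h
    rw [hTt] at this
    simp at this
    exact ht.ne' this
  have heig : ∀ (M N : Matrix (Fin n) (Fin n) ℂ) (_ : M = N) (hM : M.IsHermitian) (hN : N.IsHermitian),
      hM.eigenvalues = hN.eigenvalues := by
    intro M N h hM hN; subst h; rfl
  have hL : ∀ e, (shift_isHermitian hA t e).eigenvalues = HCIZ.eg a T e := by
    intro e
    exact heig _ _ (HCIZ.paramMatrix_shift a e (√t)).symm _ _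
  simp only [hL]
  have hlaw := HCIZ.law hT0 a hdist
  have hm : ∀ σ : Equiv.Perm (Fin n), Measurable (fun e => HCIZ.eg a T e ∘ σ) := by
    intro σ
    exact (HCIZ.perm_mp σ).measurable.comp (HCIZ.measurable_eg a T)
  have h1 := congrArg (fun μ => ∫⁻ x, g x ∂μ) hlaw
  rw [lintegral_finsetSum_measure] at h1
  have h2 : ∀ σ : Equiv.Perm (Fin n),
      ∫⁻ x, g x ∂((gueParamMeasure n).map (fun e => HCIZ.eg a T e ∘ σ)) =
      ∫⁻ e, g (HCIZ.eg a T e) ∂(gueParamMeasure n) := by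
    intro σ
    rw [lintegral_map hg (hm σ)]
    simp only [hsymm]
  simp only [h2, Finset.sum_const, Finset.card_univ, Fintype.card_perm, Fintype.card_fin,
    nsmul_eq_mul] at h1
  have hmd : Measurable (fun x => ENNReal.ofReal (HCIZ.dens (paramMatrix_isHermitian a).eigenvalues T x /
      (Matrix.vandermonde (paramMatrix_isHermitian a).eigenvalues).det)) :=
    ((HCIZ.measurable_dens _ _).div_const _).ennreal_ofReal
  rw [lintegral_withDensity_eq_lintegral_mul _ hmd hg] at h1
  have hpt : ∀ x : Fin n → ℝ, g x * ENNReal.ofReal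
        ((1 / ((n.factorial : ℝ) * (2 * Real.pi * t) ^ ((n : ℝ) / 2))) *
          (Matrix.of fun i j : Fin n =>
            Real.exp (-(x i - hA.eigenvalues j) ^ 2 / (2 * t))).det *
          (Matrix.vandermonde x).det / (Matrix.vandermonde hA.eigenvalues).det) =
      (n.factorial : ℝ≥0∞)⁻¹ * (ENNReal.ofReal (HCIZ.dens (paramMatrix_isHermitian a).eigenvalues T x /
      (Matrix.vandermonde (paramMatrix_isHermitian a).eigenvalues).det) * g x) := by
    intro x
    have hdet : (Matrix.of fun i j : Fin n =>
        ProbabilityTheory.gaussianPDFReal ((paramMatrix_isHermitian a).eigenvalues j) T (x i)).det =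
        ((√(2 * Real.pi * t))⁻¹) ^ n * (Matrix.of fun i j : Fin n =>
            Real.exp (-(x i - hA.eigenvalues j) ^ 2 / (2 * t))).det := by
      have : (Matrix.of fun i j : Fin n =>
        ProbabilityTheory.gaussianPDFReal ((paramMatrix_isHermitian a).eigenvalues j) T (x i)) =
        (√(2 * Real.pi * t))⁻¹ • (Matrix.of fun i j : Fin n =>
            Real.exp (-(x i - hA.eigenvalues j) ^ 2 / (2 * t))) := by
        ext i j
        simp [ProbabilityTheory.gaussianPDFReal, hTt]
      rw [this, Matrix.det_smul, Fintype.card_fin]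
    have hpow : (2 * Real.pi * t) ^ ((n : ℝ) / 2) = (√(2 * Real.pi * t)) ^ n := by
      rw [Real.sqrt_eq_rpow, ← Real.rpow_natCast, ← Real.rpow_mul (by positivity)]
      congr 1; ring
    have hn : (n.factorial : ℝ≥0∞)⁻¹ = ENNReal.ofReal ((n.factorial : ℝ)⁻¹) := by
      rw [ENNReal.ofReal_inv_of_pos (by positivity), ENNReal.ofReal_natCast]
    rw [hn, ← mul_assoc, ← ENNReal.ofReal_mul (by positivity), mul_comm (g x), HCIZ.dens, hdet, hpow]
    congr 2
    rw [inv_pow, one_div, mul_inv]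
    ring
  simp only [hpt]
  simp only [Pi.mul_apply] at h1
  rw [lintegral_const_mul _ (by exact hmd.mul hg), ← h1, ← mul_assoc, ENNReal.inv_mul_cancel, one_mul]
  · exact_mod_cast n.factorial_ne_zero
  · exact ENNReal.natCast_ne_top _
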